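/- arXiv:2004.01003 — 2 statements merged into one kernel-verified Lean document; each statement's English description precedes it below -/
import Mathlib

section
/- There exist absolute constants c₁, c₂ > 0 such that for every integer N > 1 there is a permutation σ of {1,…,N} for which the operator norm of T_{σ,N} from L²(𝕋) to L²(𝕋) satisfies c₁·log N ≤ ‖T_{σ,N}‖_{L²→L²} ≤ c₂·log N. -/
open MeasureTheory Filter

/-- The complex exponential `e^{2πinx}`. -/
noncomputable def trigChar (n : ℤ) (x : ℝ) : ℂ :=
  Complex.exp (2 * Real.pi * Complex.I * n * x)

/-- The `L²` norm over one period `[0,1]` of the torus `𝕋 = ℝ/ℤ`. -/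
noncomputable def l2normT {E : Type*} [NormedAddCommGroup E] (f : ℝ → E) : ℝ :=
  (∫ x in (0:ℝ)..1, ‖f x‖ ^ 2) ^ ((1:ℝ)/2)

/-- The `n`-th Fourier coefficient of `f : 𝕋 → ℂ`. -/
noncomputable def fourierCoef (f : ℝ → ℂ) (n : ℤ) : ℂ :=
  ∫ x in (0:ℝ)..1, f x * Complex.exp (-(2 * Real.pi * Complex.I * n * x))

/-- The maximal operator of partial sums of the `σ`-rearranged trigonometric system:
`T_{σ,N} f (x) = max_{1 ≤ m ≤ N} |∑_{k=1}^m c_{σ(k)} e^{2πiσ(k)x}|`. -/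
noncomputable def Tmax (N : ℕ) (σ : ℕ → ℕ) (f : ℝ → ℂ) (x : ℝ) : ℝ :=
  ⨆ m : Finset.Icc 1 N,
    ‖∑ k ∈ Finset.Icc 1 (m : ℕ), fourierCoef f (σ k : ℤ) * trigChar (σ k : ℤ) x‖


open scoped ComplexConjugate

lemma trigChar_continuous (n : ℤ) : Continuous (trigChar n) := by
  unfold trigChar; fun_prop

lemma trigChar_eq (n : ℤ) (x : ℝ) :
    trigChar n x = Complex.exp (((2 * Real.pi * n * x : ℝ) : ℂ) * Complex.I) := by
  unfold trigChar; congr 1; push_cast; ring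

lemma trigChar_norm (n : ℤ) (x : ℝ) : ‖trigChar n x‖ = 1 := by
  rw [trigChar_eq, Complex.norm_exp_ofReal_mul_I]

lemma trigChar_conj (n : ℤ) (x : ℝ) :
    conj (trigChar n x) = Complex.exp (-(2 * Real.pi * Complex.I * n * x)) := by
  unfold trigChar
  rw [← Complex.exp_conj]
  congr 1
  simp only [map_mul, Complex.conj_ofReal, Complex.conj_I, map_intCast, map_ofNat]
  ring

lemma trigChar_mul_conj (m n : ℤ) (x : ℝ) :
    trigChar m x * conj (trigChar n x) = trigChar (m - n) x := by
  rw [trigChar_conj]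
  unfold trigChar
  rw [← Complex.exp_add]
  congr 1
  push_cast; ring

lemma trigChar_integral (n : ℤ) :
    ∫ x in (0:ℝ)..1, trigChar n x = if n = 0 then 1 else 0 := by
  unfold trigChar
  split_ifs with h
  · subst h; simp
  · have hc : (2 * Real.pi * Complex.I * n : ℂ) ≠ 0 := by
      have : (n : ℂ) ≠ 0 := by exact_mod_cast h
      have := Complex.two_pi_I_ne_zero
      positivity
    rw [integral_exp_mul_complex hc]
    have : Complex.exp (2 * Real.pi * Complex.I * n * (1:ℝ)) = 1 := by
      rw [Complex.exp_eq_one_iff]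
      exact ⟨n, by push_cast; ring⟩
    rw [this]; simp

lemma trigChar_orth (m n : ℤ) :
    ∫ x in (0:ℝ)..1, trigChar m x * conj (trigChar n x) = if m = n then 1 else 0 := by
  simp_rw [trigChar_mul_conj]
  rw [trigChar_integral]
  simp [sub_eq_zero]

lemma conj_cont {f : ℝ → ℂ} (hf : Continuous f) : Continuous (fun x => conj (f x)) :=
  Complex.continuous_conj.comp hf

/-- trigonometric polynomial -/
noncomputable def tpoly (s : Finset ℤ) (a : ℤ → ℂ) (x : ℝ) : ℂ := ∑ n ∈ s, a n * trigChar n x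

lemma tpoly_continuous (s : Finset ℤ) (a : ℤ → ℂ) : Continuous (tpoly s a) := by
  unfold tpoly
  exact continuous_finsetSum _ fun n _ => continuous_const.mul (trigChar_continuous n)

lemma fourierCoef_tpoly (s : Finset ℤ) (a : ℤ → ℂ) (k : ℤ) :
    fourierCoef (tpoly s a) k = if k ∈ s then a k else 0 := by
  unfold fourierCoef
  simp_rw [← trigChar_conj]
  unfold tpoly
  simp_rw [Finset.sum_mul, mul_assoc]
  rw [intervalIntegral.integral_finsetSum]
  · simp_rw [intervalIntegral.integral_const_mul, trigChar_orth]
    simp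
  · intro i _
    exact (continuous_const.mul ((trigChar_continuous i).mul
      (conj_cont (trigChar_continuous k)))).intervalIntegrable _ _

lemma integral_mul_conj_tpoly (s : Finset ℤ) (a : ℤ → ℂ) (f : ℝ → ℂ)
    (hf : IntervalIntegrable f volume 0 1) :
    ∫ x in (0:ℝ)..1, f x * conj (tpoly s a x) = ∑ n ∈ s, conj (a n) * fourierCoef f n := by
  unfold fourierCoef tpoly
  simp_rw [← trigChar_conj, map_sum, Finset.mul_sum, map_mul]
  rw [intervalIntegral.integral_finsetSum]
  · refine Finset.sum_congr rfl fun n _ => ?_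
    rw [← intervalIntegral.integral_const_mul]
    congr 1; ext x; ring
  · intro i _
    exact hf.mul_continuousOn
      (continuous_const.mul (conj_cont (trigChar_continuous i))).continuousOn

lemma tpoly_parseval (s : Finset ℤ) (a : ℤ → ℂ) :
    ∫ x in (0:ℝ)..1, ‖tpoly s a x‖ ^ 2 = ∑ n ∈ s, ‖a n‖ ^ 2 := by
  have h := integral_mul_conj_tpoly s a (tpoly s a)
    ((tpoly_continuous s a).intervalIntegrable _ _)
  have h1 : ∀ x, tpoly s a x * conj (tpoly s a x) = ((‖tpoly s a x‖ ^ 2 : ℝ) : ℂ) := by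
    intro x; rw [Complex.mul_conj, Complex.normSq_eq_norm_sq]
  simp_rw [h1] at h
  rw [intervalIntegral.integral_ofReal] at h
  have h2 : ∑ n ∈ s, conj (a n) * fourierCoef (tpoly s a) n = ((∑ n ∈ s, ‖a n‖ ^ 2 : ℝ) : ℂ) := by
    push_cast
    refine Finset.sum_congr rfl fun n hn => ?_
    rw [fourierCoef_tpoly, if_pos hn, mul_comm, Complex.mul_conj, Complex.normSq_eq_norm_sq]
    push_cast; rfl
  rw [h2] at h
  exact_mod_cast h

lemma bessel (s : Finset ℤ) (f : ℝ → ℂ)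
    (hf : MemLp f 2 (volume.restrict (Set.Ioc (0:ℝ) 1))) :
    ∑ n ∈ s, ‖fourierCoef f n‖ ^ 2 ≤ ∫ x in (0:ℝ)..1, ‖f x‖ ^ 2 := by
  set g := tpoly s (fourierCoef f) with hg
  have hgc : Continuous g := tpoly_continuous _ _
  have hf1 : IntervalIntegrable f volume 0 1 := by
    rw [intervalIntegrable_iff_integrableOn_Ioc_of_le zero_le_one]
    exact hf.integrable (by norm_num)
  have hf2 : IntervalIntegrable (fun x => ‖f x‖ ^ 2) volume 0 1 := by
    rw [intervalIntegrable_iff_integrableOn_Ioc_of_le zero_le_one]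
    exact hf.integrable_norm_pow (by norm_num)
  have hfg : IntervalIntegrable (fun x => f x * conj (g x)) volume 0 1 :=
    hf1.mul_continuousOn (conj_cont hgc).continuousOn
  have hfgr : IntervalIntegrable (fun x => (f x * conj (g x)).re) volume 0 1 := by
    rw [intervalIntegrable_iff_integrableOn_Ioc_of_le zero_le_one] at hfg ⊢
    exact hfg.re
  have hgi : IntervalIntegrable (fun x => ‖g x‖ ^ 2) volume 0 1 :=
    (hgc.norm.pow 2).intervalIntegrable _ _
  have h0 : 0 ≤ ∫ x in (0:ℝ)..1, ‖f x - g x‖ ^ 2 :=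
    intervalIntegral.integral_nonneg zero_le_one fun x _ => by positivity
  have h1 : ∀ x, ‖f x - g x‖ ^ 2 = ‖f x‖ ^ 2 + ‖g x‖ ^ 2 - 2 * (f x * conj (g x)).re := by
    intro x
    rw [← Complex.normSq_eq_norm_sq, Complex.normSq_sub, Complex.normSq_eq_norm_sq,
      Complex.normSq_eq_norm_sq]
  simp_rw [h1] at h0
  rw [intervalIntegral.integral_sub (hf2.add hgi) (hfgr.const_mul 2),
    intervalIntegral.integral_add hf2 hgi, intervalIntegral.integral_const_mul] at h0
  have h2 : ∫ x in (0:ℝ)..1, (f x * conj (g x)).re = ∑ n ∈ s, ‖fourierCoef f n‖ ^ 2 := by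
    have e1 : ∫ x in (0:ℝ)..1, (f x * conj (g x)).re =
        (∫ x in (0:ℝ)..1, f x * conj (g x)).re := by
      rw [intervalIntegral.integral_of_le zero_le_one, intervalIntegral.integral_of_le zero_le_one]
      rw [intervalIntegrable_iff_integrableOn_Ioc_of_le zero_le_one] at hfg
      exact integral_re hfg
    rw [e1, hg, integral_mul_conj_tpoly s _ f hf1, Complex.re_sum]
    refine Finset.sum_congr rfl fun n _ => ?_
    rw [mul_comm, Complex.mul_conj, Complex.normSq_eq_norm_sq]
    exact Complex.ofReal_re _
  rw [h2, hg, tpoly_parseval] at h0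
  linarith

/-- dyadic square sums for the Rademacher–Menshov argument -/
noncomputable def rmQ : ℕ → (ℕ → ℂ) → ℝ
  | 0, z => ‖z 0‖ ^ 2
  | L + 1, z => ∑ k ∈ Finset.range (2 ^ (L + 1)), ‖z k‖ ^ 2 +
      rmQ L (fun i => z (2 * i) + z (2 * i + 1))

lemma rmQ_nonneg (L : ℕ) : ∀ z, 0 ≤ rmQ L z := by
  induction L with
  | zero => intro z; simp only [rmQ]; positivity
  | succ L ih => intro z; simp only [rmQ]; have := ih (fun i => z (2 * i) + z (2 * i + 1)); positivity

lemma sum_range_pairs (z : ℕ → ℂ) (n : ℕ) :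
    ∑ k ∈ Finset.range (2 * n), z k = ∑ i ∈ Finset.range n, (z (2 * i) + z (2 * i + 1)) := by
  induction n with
  | zero => simp
  | succ n ih =>
    rw [show 2 * (n + 1) = 2 * n + 1 + 1 by ring, Finset.sum_range_succ, Finset.sum_range_succ,
      Finset.sum_range_succ, ih]; ring

lemma sum_range_pairs_real (z : ℕ → ℝ) (n : ℕ) :
    ∑ k ∈ Finset.range (2 * n), z k = ∑ i ∈ Finset.range n, (z (2 * i) + z (2 * i + 1)) := by
  induction n with
  | zero => simp
  | succ n ih =>
    rw [show 2 * (n + 1) = 2 * n + 1 + 1 by ring, Finset.sum_range_succ, Finset.sum_range_succ,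
      Finset.sum_range_succ, ih]; ring

lemma rm_step {a b p q l : ℝ} (ha : 0 ≤ a) (hb : 0 ≤ b) (hl : 0 < l) (h1 : a ^ 2 ≤ l * p)
    (h2 : b ^ 2 ≤ q) : (a + b) ^ 2 ≤ (l + 1) * (q + p) := by
  have h3 : 2 * a * b * l ≤ a ^ 2 + b ^ 2 * l ^ 2 := by nlinarith [sq_nonneg (a - b * l)]
  have h4 : (a + b) ^ 2 * l ≤ (l + 1) * (b ^ 2 * l + a ^ 2) := by nlinarith
  have h5 : (a + b) ^ 2 * l ≤ ((l + 1) * (q + p)) * l := by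
    calc _ ≤ _ := h4
      _ ≤ (l + 1) * (q * l + l * p) := by
        apply mul_le_mul_of_nonneg_left _ (by linarith)
        have := mul_le_mul_of_nonneg_right h2 hl.le
        linarith
      _ = _ := by ring
  exact le_of_mul_le_mul_right h5 hl

lemma rm_pointwise (L : ℕ) : ∀ (z : ℕ → ℂ) (m : ℕ), m ≤ 2 ^ L →
    ‖∑ k ∈ Finset.range m, z k‖ ^ 2 ≤ (L + 1) * rmQ L z := by
  induction L with
  | zero =>
    intro z m hm
    simp only [pow_zero] at hm
    interval_cases m <;> simp [rmQ]
  | succ L ih =>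
    intro z m hm
    simp only [rmQ]
    set z' : ℕ → ℂ := fun i => z (2 * i) + z (2 * i + 1) with hz'
    have hm2 : m / 2 ≤ 2 ^ L := by rw [pow_succ] at hm; omega
    have h1 := ih z' (m / 2) hm2
    have key : ∃ b : ℂ, ∑ k ∈ Finset.range m, z k = ∑ i ∈ Finset.range (m / 2), z' i + b ∧
        ‖b‖ ^ 2 ≤ ∑ k ∈ Finset.range (2 ^ (L + 1)), ‖z k‖ ^ 2 := by
      rcases Nat.even_or_odd' m with ⟨t, rfl | rfl⟩
      · refine ⟨0, ?_, ?_⟩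
        · rw [sum_range_pairs]; simp [hz']
        · simp; positivity
      · refine ⟨z (2 * t), ?_, ?_⟩
        · rw [Finset.sum_range_succ, sum_range_pairs, show (2 * t + 1) / 2 = t by omega]
        · exact Finset.single_le_sum (f := fun k => ‖z k‖ ^ 2) (fun k _ => by positivity)
            (Finset.mem_range.2 (by omega))
    obtain ⟨b, hb1, hb2⟩ := key
    rw [hb1]
    have hn := norm_add_le (∑ i ∈ Finset.range (m / 2), z' i) b
    calc _ ≤ (‖∑ i ∈ Finset.range (m / 2), z' i‖ + ‖b‖) ^ 2 := by gcongr
      _ ≤ _ := by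
        push_cast
        exact rm_step (norm_nonneg _) (norm_nonneg _) (by positivity) h1 hb2

lemma rmQ_continuous (L : ℕ) : ∀ z : ℕ → ℝ → ℂ, (∀ k, Continuous (z k)) →
    Continuous (fun x => rmQ L (fun k => z k x)) := by
  induction L with
  | zero => intro z hz; simp only [rmQ]; exact (hz 0).norm.pow 2
  | succ L ih =>
    intro z hz
    simp only [rmQ]
    exact (continuous_finsetSum _ fun k _ => (hz k).norm.pow 2).add
      (ih (fun i x => z (2 * i) x + z (2 * i + 1) x) fun k => (hz _).add (hz _))

lemma rm_integral (L : ℕ) : ∀ z : ℕ → ℝ → ℂ, (∀ k, Continuous (z k)) →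
    (∀ i j, i ≠ j → ∫ x in (0:ℝ)..1, (z i x * conj (z j x)).re = 0) →
    ∫ x in (0:ℝ)..1, rmQ L (fun k => z k x) =
      (L + 1) * ∑ k ∈ Finset.range (2 ^ L), ∫ x in (0:ℝ)..1, ‖z k x‖ ^ 2 := by
  induction L with
  | zero => intro z hz ho; simp [rmQ]
  | succ L ih =>
    intro z hz ho
    simp only [rmQ]
    have hii : ∀ i j, IntervalIntegrable (fun x => (z i x * conj (z j x)).re) volume 0 1 :=
      fun i j => (Complex.continuous_re.comp ((hz i).mul (conj_cont (hz j)))).intervalIntegrable _ _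
    have hni : ∀ i, IntervalIntegrable (fun x => ‖z i x‖ ^ 2) volume 0 1 :=
      fun i => ((hz i).norm.pow 2).intervalIntegrable _ _
    have hz'c : ∀ i, Continuous (fun x => z (2 * i) x + z (2 * i + 1) x) :=
      fun i => (hz _).add (hz _)
    have hA : IntervalIntegrable (fun x => ∑ k ∈ Finset.range (2 ^ (L + 1)), ‖z k x‖ ^ 2)
        volume 0 1 :=
      (continuous_finsetSum _ fun k _ => (hz k).norm.pow 2).intervalIntegrable _ _
    have hB : IntervalIntegrable (fun x => rmQ L (fun i => z (2 * i) x + z (2 * i + 1) x))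
        volume 0 1 :=
      (rmQ_continuous L (fun i x => z (2 * i) x + z (2 * i + 1) x) hz'c).intervalIntegrable _ _
    rw [intervalIntegral.integral_add hA hB]
    rw [ih (fun i x => z (2 * i) x + z (2 * i + 1) x) hz'c]
    · rw [intervalIntegral.integral_finsetSum fun i _ => hni i]
      have e1 : ∀ i, ∫ x in (0:ℝ)..1, ‖z (2 * i) x + z (2 * i + 1) x‖ ^ 2 =
          (∫ x in (0:ℝ)..1, ‖z (2 * i) x‖ ^ 2) + ∫ x in (0:ℝ)..1, ‖z (2 * i + 1) x‖ ^ 2 := by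
        intro i
        have h1 : ∀ x, ‖z (2 * i) x + z (2 * i + 1) x‖ ^ 2 = ‖z (2 * i) x‖ ^ 2 +
            ‖z (2 * i + 1) x‖ ^ 2 + 2 * (z (2 * i) x * conj (z (2 * i + 1) x)).re := by
          intro x
          rw [← Complex.normSq_eq_norm_sq, Complex.normSq_add, Complex.normSq_eq_norm_sq,
            Complex.normSq_eq_norm_sq]
        simp_rw [h1]
        rw [intervalIntegral.integral_add ((hni _).add (hni _)) ((hii _ _).const_mul 2),
          intervalIntegral.integral_add (hni _) (hni _), intervalIntegral.integral_const_mul,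
          ho _ _ (by omega)]
        ring
      simp_rw [e1]
      rw [← sum_range_pairs_real (fun k => ∫ x in (0:ℝ)..1, ‖z k x‖ ^ 2), pow_succ, mul_comm 2]
      push_cast; ring
    · intro i j hij
      have h1 : ∀ x, ((z (2 * i) x + z (2 * i + 1) x) *
          conj (z (2 * j) x + z (2 * j + 1) x)).re =
          ((z (2 * i) x * conj (z (2 * j) x)).re + (z (2 * i) x * conj (z (2 * j + 1) x)).re) +
          ((z (2 * i + 1) x * conj (z (2 * j) x)).re +
            (z (2 * i + 1) x * conj (z (2 * j + 1) x)).re) := by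
        intro x
        simp only [map_add, add_mul, mul_add, Complex.add_re]
        ring
      simp_rw [h1]
      rw [intervalIntegral.integral_add ((hii _ _).add (hii _ _)) ((hii _ _).add (hii _ _)),
        intervalIntegral.integral_add (hii _ _) (hii _ _),
        intervalIntegral.integral_add (hii _ _) (hii _ _),
        ho _ _ (by omega), ho _ _ (by omega), ho _ _ (by omega), ho _ _ (by omega)]
      simp

lemma l2normT_le {E : Type*} [NormedAddCommGroup E] {f : ℝ → E} {C : ℝ} (hC : 0 ≤ C)
    (h : ∫ x in (0:ℝ)..1, ‖f x‖ ^ 2 ≤ C ^ 2) : l2normT f ≤ C := by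
  unfold l2normT
  rw [← Real.sqrt_eq_rpow]
  exact Real.sqrt_le_iff.2 ⟨hC, h⟩

lemma le_l2normT {E : Type*} [NormedAddCommGroup E] {f : ℝ → E} {C : ℝ}
    (h : C ^ 2 ≤ ∫ x in (0:ℝ)..1, ‖f x‖ ^ 2) : C ≤ l2normT f := by
  unfold l2normT
  rw [← Real.sqrt_eq_rpow]
  exact Real.le_sqrt_of_sq_le h

lemma l2normT_le_one {f : ℝ → ℂ} (h : l2normT f ≤ 1) : ∫ x in (0:ℝ)..1, ‖f x‖ ^ 2 ≤ 1 := by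
  unfold l2normT at h
  rw [← Real.sqrt_eq_rpow, Real.sqrt_le_one] at h
  exact h

/-- Rademacher–Menshov upper bound. -/
lemma upper_bound (N : ℕ) (hN : 1 < N) (σ : ℕ → ℕ)
    (hσ : Set.BijOn σ (Set.Icc 1 N) (Set.Icc 1 N)) (f : ℝ → ℂ)
    (hf : MemLp f 2 (volume.restrict (Set.Ioc (0:ℝ) 1))) (hf1 : l2normT f ≤ 1) :
    l2normT (Tmax N σ f) ≤ 3 / Real.log 2 * Real.log N := by
  set L := Nat.log 2 N + 1 with hL
  have hNL : N ≤ 2 ^ L := (Nat.lt_pow_succ_log_self (by norm_num) N).le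
  have hlog2 : 0 < Real.log 2 := Real.log_pos (by norm_num)
  have hLle : ((L : ℝ) + 1) ≤ 3 / Real.log 2 * Real.log N := by
    have h1 : (Nat.log 2 N : ℝ) * Real.log 2 ≤ Real.log N := by
      rw [← Real.log_pow]
      apply Real.log_le_log (by positivity)
      exact_mod_cast Nat.pow_log_le_self 2 (by omega)
    have h2 : Real.log 2 ≤ Real.log N := Real.log_le_log (by norm_num) (by exact_mod_cast hN)
    rw [div_mul_eq_mul_div, le_div_iff₀ hlog2, hL]
    push_cast
    nlinarith
  set z : ℕ → ℝ → ℂ := fun k x => if k < N then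
    fourierCoef f (σ (k + 1) : ℤ) * trigChar (σ (k + 1) : ℤ) x else 0 with hz
  have hzc : ∀ k, Continuous (z k) := by
    intro k
    simp only [hz]
    split_ifs
    · exact continuous_const.mul (trigChar_continuous _)
    · exact continuous_const
  have hinj : ∀ i j, i < N → j < N → σ (i + 1) = σ (j + 1) → i = j := by
    intro i j hi hj h
    have := hσ.injOn (show i + 1 ∈ Set.Icc 1 N from ⟨by omega, by omega⟩)
      (show j + 1 ∈ Set.Icc 1 N from ⟨by omega, by omega⟩) h
    omega
  have hzo : ∀ i j, i ≠ j → ∫ x in (0:ℝ)..1, (z i x * conj (z j x)).re = 0 := by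
    intro i j hij
    have hc : ∫ x in (0:ℝ)..1, z i x * conj (z j x) = 0 := by
      by_cases hi : i < N
      · by_cases hj : j < N
        · have : ∀ x, z i x * conj (z j x) =
              (fourierCoef f (σ (i + 1) : ℤ) * conj (fourierCoef f (σ (j + 1) : ℤ))) *
              (trigChar (σ (i + 1) : ℤ) x * conj (trigChar (σ (j + 1) : ℤ) x)) := by
            intro x; simp only [hz, hi, hj, if_true, map_mul]; ring
          simp_rw [this]
          rw [intervalIntegral.integral_const_mul, trigChar_orth, if_neg, mul_zero]
          intro h
          exact hij (hinj i j hi hj (by exact_mod_cast h))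
        · simp [hz, hj]
      · simp [hz, hi]
    have hintg : IntervalIntegrable (fun x => z i x * conj (z j x)) volume 0 1 :=
      ((hzc i).mul (conj_cont (hzc j))).intervalIntegrable _ _
    have e1 : ∫ x in (0:ℝ)..1, (z i x * conj (z j x)).re =
        (∫ x in (0:ℝ)..1, z i x * conj (z j x)).re := by
      rw [intervalIntegral.integral_of_le zero_le_one, intervalIntegral.integral_of_le zero_le_one]
      rw [intervalIntegrable_iff_integrableOn_Ioc_of_le zero_le_one] at hintg
      exact integral_re hintg
    rw [e1, hc]; rfl
  have hzn : ∀ k, ∫ x in (0:ℝ)..1, ‖z k x‖ ^ 2 =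
      if k < N then ‖fourierCoef f (σ (k + 1) : ℤ)‖ ^ 2 else 0 := by
    intro k
    split_ifs with h
    · simp [hz, h, trigChar_norm]
    · simp [hz, h]
  have hsum : ∑ k ∈ Finset.range (2 ^ L), ∫ x in (0:ℝ)..1, ‖z k x‖ ^ 2 ≤ 1 := by
    simp_rw [hzn]
    rw [← Finset.sum_filter]
    have hset : (Finset.range (2 ^ L)).filter (· < N) = Finset.range N := by
      ext k; simp; omega
    rw [hset]
    have := bessel ((Finset.range N).image (fun k => (σ (k + 1) : ℤ))) f hf
    rw [Finset.sum_image] at this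
    · exact this.trans (l2normT_le_one hf1)
    · intro i hi j hj h
      have h' : (σ (i + 1) : ℤ) = σ (j + 1) := h
      exact hinj i j (by simpa using hi) (by simpa using hj) (by exact_mod_cast h')
  have hpt : ∀ x, ‖Tmax N σ f x‖ ^ 2 ≤ (L + 1) * rmQ L (fun k => z k x) := by
    intro x
    have : Nonempty (Finset.Icc 1 N) := ⟨⟨1, by simp; omega⟩⟩
    obtain ⟨m, hm⟩ := exists_eq_ciSup_of_finite
      (f := fun m : Finset.Icc 1 N => ‖∑ k ∈ Finset.Icc 1 (m : ℕ),
        fourierCoef f (σ k : ℤ) * trigChar (σ k : ℤ) x‖)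
    have hT : Tmax N σ f x = _ := hm.symm
    rw [hT]
    have hmN : (m : ℕ) ≤ N := (Finset.mem_Icc.1 m.2).2
    have := rm_pointwise L (fun k => z k x) m (hmN.trans hNL)
    rw [norm_norm]
    have hs : ∑ k ∈ Finset.Icc 1 (m : ℕ), fourierCoef f (σ k : ℤ) * trigChar (σ k : ℤ) x =
        ∑ k ∈ Finset.range (m : ℕ), z k x := by
      rw [Finset.range_eq_Ico, ← Finset.Ico_add_one_right_eq_Icc,
        ← Finset.sum_Ico_add' (fun k => fourierCoef f (σ k : ℤ) * trigChar (σ k : ℤ) x) 0 (m : ℕ) 1]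
      refine Finset.sum_congr rfl fun k hk => ?_
      have : k < N := by have := (Finset.mem_Ico.1 hk).2; omega
      simp [hz, this]
    rw [hs]
    exact this
  have hpos : 0 ≤ 3 / Real.log 2 * Real.log N := le_trans (by positivity) hLle
  apply l2normT_le hpos
  have hintg : ∫ x in (0:ℝ)..1, ‖Tmax N σ f x‖ ^ 2 ≤
      ∫ x in (0:ℝ)..1, (L + 1) * rmQ L (fun k => z k x) := by
    rw [intervalIntegral.integral_of_le zero_le_one, intervalIntegral.integral_of_le zero_le_one]
    apply integral_mono_of_nonneg
    · exact Eventually.of_forall fun x => by positivity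
    · have := ((continuous_const.mul (rmQ_continuous L z hzc) : Continuous
        fun x => ((L:ℝ) + 1) * rmQ L (fun k => z k x))).intervalIntegrable (μ := volume) 0 1
      rwa [intervalIntegrable_iff_integrableOn_Ioc_of_le zero_le_one] at this
    · exact Eventually.of_forall hpt
  refine hintg.trans ?_
  rw [intervalIntegral.integral_const_mul, rm_integral L z hzc hzo]
  calc ((L:ℝ) + 1) * ((L + 1) * ∑ k ∈ Finset.range (2 ^ L), ∫ x in (0:ℝ)..1, ‖z k x‖ ^ 2)
      ≤ (L + 1) * ((L + 1) * 1) := by gcongr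
    _ = (L + 1) ^ 2 := by ring
    _ ≤ _ := by gcongr

/-! ### Lower bound -/

/-- harmonic sums -/
noncomputable def hsum (n : ℕ) : ℝ := ∑ a ∈ Finset.range n, 1 / ((a : ℝ) + 1)

lemma hsum_eq (n : ℕ) : hsum n = (harmonic n : ℝ) := by
  unfold hsum harmonic
  push_cast
  refine Finset.sum_congr rfl fun a _ => ?_
  rw [one_div]

lemma hsum_le (n : ℕ) : hsum n ≤ 1 + Real.log n := by
  rw [hsum_eq]; exact harmonic_le_one_add_log n

lemma le_hsum (n : ℕ) (hn : 1 ≤ n) : Real.log n ≤ hsum n := by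
  rw [hsum_eq]
  refine le_trans ?_ (log_add_one_le_harmonic n)
  apply Real.log_le_log
  · exact_mod_cast hn
  · push_cast; linarith

lemma exists_sorted (N : ℕ) (key : ℕ → ℝ) :
    ∃ σ : ℕ → ℕ, Set.BijOn σ (Set.Icc 1 N) (Set.Icc 1 N) ∧
      MonotoneOn (fun k => key (σ k)) (Set.Icc 1 N) := by
  set κ : Fin N → ℝ := fun i => key (i + 1) with hκ
  set τ := Tuple.sort κ with hτ
  have hmono : Monotone (κ ∘ τ) := Tuple.monotone_sort κ
  set σ : ℕ → ℕ := fun k => if h : k - 1 < N then (τ ⟨k - 1, h⟩ : ℕ) + 1 else 0 with hσ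
  have hval : ∀ k (hk : k ∈ Set.Icc 1 N), σ k =
      (τ ⟨k - 1, by have := hk.1; have := hk.2; omega⟩ : ℕ) + 1 := by
    intro k hk
    have : k - 1 < N := by have := hk.1; have := hk.2; omega
    simp only [hσ, this, dif_pos]
  refine ⟨σ, ⟨?_, ?_, ?_⟩, ?_⟩
  · intro k hk
    rw [hval k hk]
    exact ⟨by omega, (τ _).2⟩
  · intro k hk l hl h
    rw [hval k hk, hval l hl] at h
    have h1 := τ.injective (Fin.ext (Nat.add_right_cancel h))
    have h2 : k - 1 = l - 1 := by simpa using h1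
    have := hk.1; have := hl.1; omega
  · intro k hk
    have hk1 : k - 1 < N := by have := hk.1; have := hk.2; omega
    refine ⟨(τ.symm ⟨k - 1, hk1⟩ : ℕ) + 1, ⟨by omega, (τ.symm _).2⟩, ?_⟩
    rw [hval _ ⟨by omega, (τ.symm _).2⟩]
    have h3 : (⟨(τ.symm ⟨k - 1, hk1⟩ : ℕ) + 1 - 1, by simp⟩ : Fin N) =
      τ.symm ⟨k - 1, hk1⟩ := by ext; simp
    rw [h3]
    simp
    have := hk.1; omega
  · intro k hk l hl hkl
    simp only
    rw [hval k hk, hval l hl]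
    apply hmono
    simp only [Fin.mk_le_mk]
    omega

lemma Tmax_ge (N : ℕ) (σ : ℕ → ℕ) (f : ℝ → ℂ) (x : ℝ) (m : ℕ) (hm1 : 1 ≤ m) (hm : m ≤ N) :
    ‖∑ k ∈ Finset.Icc 1 m, fourierCoef f (σ k : ℤ) * trigChar (σ k : ℤ) x‖ ≤ Tmax N σ f x :=
  le_ciSup (f := fun m : Finset.Icc 1 N => ‖∑ k ∈ Finset.Icc 1 (m : ℕ),
    fourierCoef f (σ k : ℤ) * trigChar (σ k : ℤ) x‖) (Set.finite_range _).bddAbove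
    ⟨m, Finset.mem_Icc.2 ⟨hm1, hm⟩⟩

lemma Tmax_nonneg (N : ℕ) (σ : ℕ → ℕ) (f : ℝ → ℂ) (x : ℝ) : 0 ≤ Tmax N σ f x :=
  Real.iSup_nonneg fun _ => norm_nonneg _

lemma Tmax_continuous (N : ℕ) (hN : 1 ≤ N) (σ : ℕ → ℕ) (f : ℝ → ℂ) :
    Continuous (Tmax N σ f) := by
  have : Nonempty (Finset.Icc 1 N) := ⟨⟨1, by simp; omega⟩⟩
  have h : Tmax N σ f = fun x => Finset.univ.sup' Finset.univ_nonempty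
      (fun m : Finset.Icc 1 N => ‖∑ k ∈ Finset.Icc 1 (m : ℕ),
        fourierCoef f (σ k : ℤ) * trigChar (σ k : ℤ) x‖) := by
    ext x
    rw [Finset.sup'_univ_eq_ciSup]; rfl
  rw [h]
  refine Continuous.finset_sup'_apply _ fun m _ => ?_
  exact (continuous_finsetSum _ fun k _ => continuous_const.mul (trigChar_continuous _)).norm

lemma Tmax_ge_filter (N : ℕ) (key : ℕ → ℝ) (σ : ℕ → ℕ)
    (hσ : Set.BijOn σ (Set.Icc 1 N) (Set.Icc 1 N))
    (hm : MonotoneOn (fun k => key (σ k)) (Set.Icc 1 N)) (f : ℝ → ℂ) (x t : ℝ) :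
    ‖∑ k ∈ (Finset.Icc 1 N).filter (fun k => key k ≤ t),
      fourierCoef f (k : ℤ) * trigChar (k : ℤ) x‖ ≤ Tmax N σ f x := by
  classical
  obtain ⟨r, hrN, hr⟩ : ∃ r ≤ N, ∀ i ∈ Set.Icc 1 N, key (σ i) ≤ t ↔ i ≤ r := by
    refine ⟨Nat.findGreatest (fun i => i ≠ 0 ∧ key (σ i) ≤ t) N, Nat.findGreatest_le _, ?_⟩
    intro i hi
    constructor
    · intro h
      exact Nat.le_findGreatest hi.2 ⟨by have := hi.1; omega, h⟩
    · intro h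
      set r := Nat.findGreatest (fun i => i ≠ 0 ∧ key (σ i) ≤ t) N with hr
      have hr0 : r ≠ 0 := by have := hi.1; omega
      have h1 := Nat.findGreatest_of_ne_zero hr.symm hr0
      have hrm : r ∈ Set.Icc 1 N := ⟨by omega, Nat.findGreatest_le _⟩
      exact (hm hi hrm h).trans h1.2
  have himg : (Finset.Icc 1 N).filter (fun k => key k ≤ t) = (Finset.Icc 1 r).image σ := by
    ext k
    simp only [Finset.mem_filter, Finset.mem_Icc, Finset.mem_image]
    constructor
    · rintro ⟨hk, hkt⟩
      obtain ⟨i, hi, rfl⟩ := hσ.surjOn (show k ∈ Set.Icc 1 N from hk)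
      exact ⟨i, ⟨hi.1, (hr i hi).1 hkt⟩, rfl⟩
    · rintro ⟨i, hi, rfl⟩
      have hi' : i ∈ Set.Icc 1 N := ⟨hi.1, hi.2.trans hrN⟩
      exact ⟨hσ.mapsTo hi', (hr i hi').2 hi.2⟩
  rw [himg, Finset.sum_image]
  · rcases Nat.eq_zero_or_pos r with h0 | h0
    · rw [h0]; simpa using Tmax_nonneg N σ f x
    · exact Tmax_ge N σ f x r h0 hrN
  · intro i hi j hj h
    have hi := Finset.mem_Icc.1 (Finset.mem_coe.1 hi)
    have hj := Finset.mem_Icc.1 (Finset.mem_coe.1 hj)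
    exact hσ.injOn (show i ∈ Set.Icc 1 N from ⟨hi.1, hi.2.trans hrN⟩)
      (show j ∈ Set.Icc 1 N from ⟨hj.1, hj.2.trans hrN⟩) h

/-- the unimodular number `e^{2πix}` -/
noncomputable def ee (x : ℝ) : ℂ := Complex.exp (((2 * Real.pi * x : ℝ) : ℂ) * Complex.I)

lemma ee_norm (x : ℝ) : ‖ee x‖ = 1 := by
  unfold ee; rw [Complex.norm_exp_ofReal_mul_I]

lemma ee_add (x y : ℝ) : ee (x + y) = ee x * ee y := by
  unfold ee; rw [← Complex.exp_add]; congr 1; push_cast; ring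

lemma ee_pow (x : ℝ) (n : ℕ) : ee x ^ n = ee (n * x) := by
  unfold ee; rw [← Complex.exp_nat_mul]; congr 1; push_cast; ring

lemma ee_nat (n : ℕ) : ee n = 1 := by
  unfold ee; rw [Complex.exp_eq_one_iff]; exact ⟨n, by push_cast; ring⟩

lemma ee_re (x : ℝ) : (ee x).re = Real.cos (2 * Real.pi * x) := by
  unfold ee; rw [Complex.exp_ofReal_mul_I_re]

lemma trigChar_ee (n : ℤ) (x : ℝ) : trigChar n x = ee (n * x) := by
  rw [trigChar_eq]; unfold ee; congr 2; push_cast; ring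

lemma ee_sub_one_norm (x : ℝ) : ‖ee x - 1‖ = |2 * Real.sin (Real.pi * x)| := by
  have h := Complex.norm_exp_I_mul_ofReal_sub_one (2 * Real.pi * x)
  unfold ee
  rw [mul_comm, h]
  rw [Real.norm_eq_abs]
  congr 3; ring

lemma ee_sub_one_le (x : ℝ) (hx : 0 ≤ x) : ‖ee x - 1‖ ≤ 2 * Real.pi * x := by
  rw [ee_sub_one_norm, abs_mul, abs_two]
  have := Real.abs_sin_le_abs (x := Real.pi * x)
  rw [abs_of_nonneg (mul_nonneg Real.pi_pos.le hx)] at this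
  linarith

lemma le_ee_sub_one (x : ℝ) (hx : 0 ≤ x) (hx2 : x ≤ 1 / 2) : 4 * x ≤ ‖ee x - 1‖ := by
  rw [ee_sub_one_norm]
  have hpi := Real.pi_pos
  have := Real.mul_le_sin (x := Real.pi * x) (by positivity) (by nlinarith)
  have h2 : 2 / Real.pi * (Real.pi * x) = 2 * x := by field_simp
  rw [h2] at this
  refine le_trans ?_ (le_abs_self _)
  linarith

lemma tail_aux (w : ℂ) (hw : ‖w‖ = 1) (M : ℕ) (hM : 1 ≤ M) (n : ℕ) (hn : M ≤ n) :
    ‖(1 - w) * (∑ a ∈ Finset.range n, 1 / ((a : ℂ) + 1) * w ^ (a + 1) -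
      ∑ a ∈ Finset.range M, 1 / ((a : ℂ) + 1) * w ^ (a + 1)) + w ^ (n + 1) / n‖ ≤
      2 / M - 1 / n := by
  induction n, hn using Nat.le_induction with
  | base =>
    simp [hw]
    apply le_of_eq; field_simp; norm_num
  | succ n hn ih =>
    have hn0 : (0:ℝ) < n := by exact_mod_cast (lt_of_lt_of_le hM hn)
    have hnc : (n:ℂ) ≠ 0 := by exact_mod_cast hn0.ne'
    have hnc1 : (n:ℂ) + 1 ≠ 0 := by exact_mod_cast Nat.succ_ne_zero n
    rw [Finset.sum_range_succ]
    set D := ∑ a ∈ Finset.range n, 1 / ((a : ℂ) + 1) * w ^ (a + 1)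
    set B := ∑ a ∈ Finset.range M, 1 / ((a : ℂ) + 1) * w ^ (a + 1)
    have e : (1 - w) * (D + 1 / ((n : ℂ) + 1) * w ^ (n + 1) - B) + w ^ (n + 1 + 1) / ((n + 1 : ℕ) : ℂ)
        = ((1 - w) * (D - B) + w ^ (n + 1) / n) + w ^ (n + 1) * (((1 / ((n:ℝ) + 1) - 1 / n : ℝ)) : ℂ) := by
      push_cast; field_simp; ring
    rw [e]
    refine (norm_add_le _ _).trans ?_
    rw [norm_mul, norm_pow, hw, one_pow, one_mul, Complex.norm_real, Real.norm_eq_abs, abs_of_nonpos]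
    · push_cast; linarith
    · rw [sub_nonpos]; apply one_div_le_one_div_of_le hn0; linarith

lemma harm_exp_bound (x : ℝ) (M A : ℕ) (hM : 1 ≤ M) (hMA : M ≤ A) (hx : 1 / (M:ℝ) ≤ x)
    (hx2 : x ≤ 1 / 2) :
    ‖∑ a ∈ Finset.range A, 1 / ((a : ℂ) + 1) * ee x ^ (a + 1)‖ ≤ 3 / 2 + Real.log M := by
  have hM0 : (0:ℝ) < M := by exact_mod_cast hM
  have hA0 : (0:ℝ) < A := by exact_mod_cast (lt_of_lt_of_le hM hMA)
  have hx0 : 0 < x := lt_of_lt_of_le (by positivity) hx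
  have h := tail_aux (ee x) (ee_norm x) M hM A hMA
  set D := ∑ a ∈ Finset.range A, 1 / ((a : ℂ) + 1) * ee x ^ (a + 1)
  set B := ∑ a ∈ Finset.range M, 1 / ((a : ℂ) + 1) * ee x ^ (a + 1) with hB
  have h1 : ‖(1 - ee x) * (D - B)‖ ≤ 2 / M := by
    have e : (1 - ee x) * (D - B) = ((1 - ee x) * (D - B) + ee x ^ (A + 1) / A) -
      ee x ^ (A + 1) / A := by ring
    rw [e]
    refine (norm_sub_le _ _).trans ?_
    have : ‖ee x ^ (A + 1) / (A:ℂ)‖ = 1 / A := by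
      rw [norm_div, norm_pow, ee_norm, one_pow, Complex.norm_natCast]
    linarith
  rw [norm_mul, norm_sub_rev] at h1
  have h2 := le_ee_sub_one x hx0.le hx2
  have h3 : ‖D - B‖ ≤ 1 / 2 := by
    have h4 : 4 / (M:ℝ) * ‖D - B‖ ≤ 2 / M := by
      refine le_trans ?_ h1
      apply mul_le_mul_of_nonneg_right _ (norm_nonneg _)
      have : 4 / (M:ℝ) = 4 * (1 / M) := by ring
      linarith
    have h5 : 4 / (M:ℝ) * ‖D - B‖ ≤ 4 / M * (1 / 2) := by
      refine h4.trans (le_of_eq ?_); ring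
    exact le_of_mul_le_mul_left h5 (by positivity)
  have h6 : ‖B‖ ≤ hsum M := by
    rw [hB]
    refine (norm_sum_le _ _).trans ?_
    unfold hsum
    refine Finset.sum_le_sum fun a _ => le_of_eq ?_
    rw [norm_mul, norm_pow, ee_norm, one_pow, mul_one, norm_div, norm_one]
    congr 1
    have : ((a:ℂ) + 1) = ((a + 1 : ℕ) : ℂ) := by push_cast; ring
    rw [this, Complex.norm_natCast]; push_cast; ring
  have h7 := hsum_le M
  have h8 : ‖D‖ ≤ ‖D - B‖ + ‖B‖ := by
    have := norm_add_le (D - B) B; simpa using this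
  linarith

lemma geom_aux (z : ℂ) (n : ℕ) :
    (∑ b ∈ Finset.range n, z ^ (b + 1)) * (z - 1) = z * (z ^ n - 1) := by
  have := geom_sum_mul z n
  rw [← this, ← mul_assoc, Finset.mul_sum]
  congr 1
  exact Finset.sum_congr rfl fun b _ => by ring

lemma key_lower (x y m : ℝ) (M A : ℕ) (hM : 1 ≤ M) (hMA : M ≤ A) (hy : 0 < y) (hy6 : y ≤ 1 / 6)
    (hm0 : 0 ≤ m) (hm1 : m ≤ 1) (hxy : x = m * y) (hx : 1 / (M:ℝ) ≤ x) :
    hsum A / 2 - (3 / 2 + Real.log M) ≤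
      ‖∑ a ∈ Finset.range A, 1 / ((a : ℂ) + 1) * ee x ^ (a + 1) *
        ∑ b ∈ Finset.range ⌊m * (a + 1)⌋₊, ee (-y) ^ (b + 1)‖ * (2 * Real.pi * y) := by
  have hx2 : x ≤ 1 / 2 := by nlinarith
  have hb := harm_exp_bound x M A hM hMA hx hx2
  set S := ∑ a ∈ Finset.range A, 1 / ((a : ℂ) + 1) * ee x ^ (a + 1) *
        ∑ b ∈ Finset.range ⌊m * (a + 1)⌋₊, ee (-y) ^ (b + 1)
  set B := ∑ a ∈ Finset.range A, 1 / ((a : ℂ) + 1) * ee x ^ (a + 1)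
  set R := ∑ a ∈ Finset.range A, 1 / ((a : ℂ) + 1) * (ee x ^ (a + 1) * ee (-y) ^ ⌊m * (a + 1)⌋₊)
    with hR
  have e1 : S * (ee (-y) - 1) = ee (-y) * (R - B) := by
    simp only [S, R, B]
    rw [Finset.sum_mul, ← Finset.sum_sub_distrib, Finset.mul_sum]
    refine Finset.sum_congr rfl fun a _ => ?_
    rw [mul_assoc, geom_aux]; ring
  have e2 : ‖S‖ * ‖ee (-y) - 1‖ = ‖R - B‖ := by
    rw [← norm_mul, e1, norm_mul, ee_norm, one_mul]
  have e3 : ‖ee (-y) - 1‖ ≤ 2 * Real.pi * y := by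
    have := ee_sub_one_le y hy.le
    rw [ee_sub_one_norm] at this ⊢
    rwa [mul_neg, Real.sin_neg, mul_neg, abs_neg]
  have e4 : ‖R - B‖ ≤ ‖S‖ * (2 * Real.pi * y) := by
    rw [← e2]; gcongr
  have e5 : hsum A / 2 ≤ ‖R‖ := by
    refine le_trans ?_ ((le_abs_self _).trans (Complex.abs_re_le_norm R))
    rw [hR, Complex.re_sum, hsum, Finset.sum_div]
    refine Finset.sum_le_sum fun a _ => ?_
    have h1 : ee x ^ (a + 1) * ee (-y) ^ ⌊m * (a + 1)⌋₊ =
        ee (y * (m * (a + 1) - ⌊m * ((a:ℝ) + 1)⌋₊)) := by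
      rw [ee_pow, ee_pow, ← ee_add, hxy]; congr 1; push_cast; ring
    have h2 : (1 / ((a:ℂ) + 1)) = ((1 / ((a:ℝ) + 1) : ℝ) : ℂ) := by push_cast; ring
    rw [h1, h2, Complex.re_ofReal_mul, ee_re, div_eq_mul_inv]
    apply mul_le_mul_of_nonneg_left _ (by positivity)
    have h3 : 0 ≤ m * ((a:ℝ) + 1) - ⌊m * ((a:ℝ) + 1)⌋₊ := by
      have := Nat.floor_le (show 0 ≤ m * ((a:ℝ) + 1) by positivity); linarith
    have h4 : m * ((a:ℝ) + 1) - ⌊m * ((a:ℝ) + 1)⌋₊ ≤ 1 := by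
      have := Nat.lt_floor_add_one (m * ((a:ℝ) + 1)); linarith
    set θ := m * ((a:ℝ) + 1) - ⌊m * ((a:ℝ) + 1)⌋₊
    have h5 : y * θ ≤ 1 / 6 := by nlinarith
    have hpi := Real.pi_pos
    rw [inv_eq_one_div, ← Real.cos_pi_div_three]
    apply Real.cos_le_cos_of_nonneg_of_le_pi
    · positivity
    · linarith
    · nlinarith
  have e6 : ‖R‖ ≤ ‖R - B‖ + ‖B‖ := by
    have := norm_add_le (R - B) B; simpa using this
  linarith

/-- index pairs -/
def prs (A : ℕ) : Finset (Σ _ : ℕ, ℕ) := (Finset.range A).sigma fun a => Finset.range (a + 1)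

/-- frequency attached to a pair -/
def frq (Λ : ℕ) (p : Σ _ : ℕ, ℕ) : ℕ := (p.1 + 1) + Λ * (p.2 + 1)

/-- slope -/
noncomputable def slope' (Λ k : ℕ) : ℝ := ((k / Λ : ℕ) : ℝ) / ((k % Λ : ℕ) : ℝ)

/-- coefficients -/
noncomputable def cf (Λ : ℕ) (c : ℝ) (k : ℤ) : ℂ := (c : ℂ) / ((k.toNat % Λ : ℕ) : ℂ)

/-- the extremal polynomial -/
noncomputable def extr (A Λ : ℕ) (c : ℝ) : ℝ → ℂ :=
  tpoly ((prs A).image fun p => (frq Λ p : ℤ)) (cf Λ c)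

lemma mem_prs {A : ℕ} {p : Σ _ : ℕ, ℕ} : p ∈ prs A ↔ p.1 < A ∧ p.2 < p.1 + 1 := by
  simp [prs]

lemma frq_mod {A Λ : ℕ} (h : A < Λ) {p : Σ _ : ℕ, ℕ} (hp : p ∈ prs A) :
    frq Λ p % Λ = p.1 + 1 := by
  have := (mem_prs.1 hp).1
  unfold frq
  rw [Nat.add_mul_mod_self_left, Nat.mod_eq_of_lt (by omega)]

lemma frq_div {A Λ : ℕ} (h : A < Λ) {p : Σ _ : ℕ, ℕ} (hp : p ∈ prs A) :
    frq Λ p / Λ = p.2 + 1 := by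
  have := (mem_prs.1 hp).1
  unfold frq
  rw [Nat.add_mul_div_left _ _ (by omega), Nat.div_eq_of_lt (by omega)]; omega

lemma frq_inj {A Λ : ℕ} (h : A < Λ) {p q : Σ _ : ℕ, ℕ} (hp : p ∈ prs A) (hq : q ∈ prs A)
    (e : frq Λ p = frq Λ q) : p = q := by
  have h1 := frq_mod h hp
  have h2 := frq_div h hp
  rw [e, frq_mod h hq] at h1
  rw [e, frq_div h hq] at h2
  rcases p with ⟨a, b⟩
  rcases q with ⟨a', b'⟩
  simp only at h1 h2
  obtain rfl : a' = a := by omega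
  obtain rfl : b' = b := by omega
  rfl

lemma frq_mem {A Λ N : ℕ} (hN : A + Λ * A ≤ N) {p : Σ _ : ℕ, ℕ} (hp : p ∈ prs A) :
    frq Λ p ∈ Finset.Icc 1 N := by
  have h := mem_prs.1 hp
  unfold frq
  rw [Finset.mem_Icc]
  refine ⟨by omega, le_trans ?_ hN⟩
  exact add_le_add (by omega) (Nat.mul_le_mul_left _ (by omega))

lemma cf_frq {A Λ : ℕ} (h : A < Λ) (c : ℝ) {p : Σ _ : ℕ, ℕ} (hp : p ∈ prs A) :
    cf Λ c (frq Λ p : ℤ) = c * (1 / ((p.1 : ℂ) + 1)) := by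
  unfold cf
  rw [Int.toNat_natCast, frq_mod h hp]
  push_cast; ring

lemma extr_energy {A Λ : ℕ} (h : A < Λ) (c : ℝ) :
    ∫ x in (0:ℝ)..1, ‖extr A Λ c x‖ ^ 2 = c ^ 2 * hsum A := by
  unfold extr
  rw [tpoly_parseval, Finset.sum_image]
  · have : ∀ p ∈ prs A, ‖cf Λ c (frq Λ p : ℤ)‖ ^ 2 = c ^ 2 * (1 / ((p.1 : ℝ) + 1)) ^ 2 := by
      intro p hp
      rw [cf_frq h c hp]
      have : (c : ℂ) * (1 / ((p.1 : ℂ) + 1)) = ((c * (1 / ((p.1 : ℝ) + 1)) : ℝ) : ℂ) := by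
        push_cast; ring
      rw [this, Complex.norm_real, Real.norm_eq_abs, sq_abs, mul_pow]
    rw [Finset.sum_congr rfl this, ← Finset.mul_sum]
    congr 1
    unfold prs hsum
    rw [Finset.sum_sigma]
    refine Finset.sum_congr rfl fun a _ => ?_
    simp only [Finset.sum_const, Finset.card_range, nsmul_eq_mul]
    push_cast
    have : (a:ℝ) + 1 ≠ 0 := by positivity
    field_simp
  · intro p hp q hq e
    have e' : (frq Λ p : ℤ) = frq Λ q := e
    exact frq_inj h hp hq (by exact_mod_cast e')

lemma extr_partial {A Λ N : ℕ} (h : A < Λ) (hN : A + Λ * A ≤ N) (c x y m : ℝ) (j : ℕ)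
    (hy : y = j - Λ * x) (hm0 : 0 ≤ m) (hm1 : m ≤ 1) :
    ∑ k ∈ (Finset.Icc 1 N).filter (fun k => slope' Λ k ≤ m),
      fourierCoef (extr A Λ c) (k : ℤ) * trigChar (k : ℤ) x =
    c * ∑ a ∈ Finset.range A, 1 / ((a : ℂ) + 1) * ee x ^ (a + 1) *
        ∑ b ∈ Finset.range ⌊m * (a + 1)⌋₊, ee (-y) ^ (b + 1) := by
  set Q : Finset (Σ _ : ℕ, ℕ) :=
    (Finset.range A).sigma fun a => Finset.range ⌊m * ((a:ℝ) + 1)⌋₊ with hQ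
  have hfl : ∀ a b : ℕ, b < ⌊m * ((a:ℝ) + 1)⌋₊ ↔ ((b:ℝ) + 1) / (a + 1) ≤ m := by
    intro a b
    rw [← Nat.add_one_le_iff, Nat.le_floor_iff (by positivity), div_le_iff₀ (by positivity)]
    push_cast; rfl
  have hQm : ∀ p, p ∈ Q ↔ p ∈ prs A ∧ ((p.2:ℝ) + 1) / (p.1 + 1) ≤ m := by
    intro p
    simp only [hQ, Finset.mem_sigma, Finset.mem_range, hfl, mem_prs]
    constructor
    · rintro ⟨h1, h2⟩
      refine ⟨⟨h1, ?_⟩, h2⟩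
      have := h2.trans hm1
      rw [div_le_one (by positivity)] at this
      exact_mod_cast (show (p.2:ℝ) < p.1 + 1 by linarith)
    · rintro ⟨⟨h1, _⟩, h2⟩; exact ⟨h1, h2⟩
  have hsl : ∀ p ∈ prs A, slope' Λ (frq Λ p) = ((p.2:ℝ) + 1) / (p.1 + 1) := by
    intro p hp
    unfold slope'
    rw [frq_mod h hp, frq_div h hp]; push_cast; rfl
  have key : ∑ p ∈ Q, (c : ℂ) * (1 / ((p.1 : ℂ) + 1)) * trigChar (frq Λ p : ℤ) x =
      ∑ k ∈ (Finset.Icc 1 N).filter (fun k => slope' Λ k ≤ m),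
      fourierCoef (extr A Λ c) (k : ℤ) * trigChar (k : ℤ) x := by
    apply Finset.sum_of_injOn (frq Λ)
    · intro p hp q hq e
      exact frq_inj h ((hQm p).1 hp).1 ((hQm q).1 hq).1 e
    · intro p hp
      have hp := (hQm p).1 hp
      rw [Finset.mem_coe, Finset.mem_filter]
      exact ⟨frq_mem hN hp.1, by rw [hsl p hp.1]; exact hp.2⟩
    · intro k hk hkn
      unfold extr
      rw [fourierCoef_tpoly, if_neg, zero_mul]
      intro hmem
      obtain ⟨p, hp, e⟩ := Finset.mem_image.1 hmem
      have e' : frq Λ p = k := by exact_mod_cast e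
      apply hkn
      refine ⟨p, ?_, e'⟩
      rw [Finset.mem_coe, hQm]
      refine ⟨hp, ?_⟩
      rw [← hsl p hp, e']
      exact (Finset.mem_filter.1 hk).2
    · intro p hp
      have hp := ((hQm p).1 hp).1
      unfold extr
      rw [fourierCoef_tpoly, if_pos (Finset.mem_image.2 ⟨p, hp, rfl⟩), cf_frq h c hp]
  rw [← key, hQ, Finset.sum_sigma, Finset.mul_sum]
  refine Finset.sum_congr rfl fun a _ => ?_
  rw [Finset.mul_sum, Finset.mul_sum]
  refine Finset.sum_congr rfl fun b _ => ?_
  have : trigChar (frq Λ ⟨a, b⟩ : ℤ) x = ee x ^ (a + 1) * ee (-y) ^ (b + 1) := by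
    rw [trigChar_ee, ee_pow, ee_pow, ← ee_add]
    have e : (((frq Λ ⟨a, b⟩ : ℕ) : ℤ) : ℝ) * x =
        (((a + 1 : ℕ) : ℝ) * x + ((b + 1 : ℕ) : ℝ) * (-y)) + ((j * (b + 1) : ℕ) : ℝ) := by
      rw [hy]; unfold frq; push_cast; ring
    rw [e, ee_add _ (((j * (b + 1) : ℕ)) : ℝ), ee_nat, mul_one]
  rw [this]; ring

lemma pointwise {A Λ N M : ℕ} (h : A < Λ) (hN : A + Λ * A ≤ N) (hM : 1 ≤ M) (hMA : M ≤ A)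
    (σ : ℕ → ℕ) (hσ : Set.BijOn σ (Set.Icc 1 N) (Set.Icc 1 N))
    (hm : MonotoneOn (fun k => slope' Λ (σ k)) (Set.Icc 1 N)) (c : ℝ) (hc : 0 ≤ c) (x y : ℝ) (j : ℕ)
    (hy : y = j - Λ * x) (hy0 : 0 < y) (hy6 : y ≤ 1 / 6) (hx : 1 / (M:ℝ) ≤ x) (hxy : x ≤ y) :
    c * (hsum A / 2 - (3 / 2 + Real.log M)) ≤
      Tmax N σ (extr A Λ c) x * (2 * Real.pi * y) := by
  have hx0 : 0 ≤ x := le_trans (by positivity) hx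
  have h1 := Tmax_ge_filter N (slope' Λ) σ hσ hm (extr A Λ c) x (x / y)
  have hm1 : x / y ≤ 1 := (div_le_one hy0).2 hxy
  have hm0 : 0 ≤ x / y := by positivity
  rw [extr_partial h hN c x y (x / y) j hy hm0 hm1, norm_mul, Complex.norm_real,
    Real.norm_eq_abs, abs_of_nonneg hc] at h1
  have h2 := key_lower x y (x / y) M A hM hMA hy0 hy6 hm0 hm1 (by field_simp) hx
  have hpi := Real.pi_pos
  calc _ ≤ c * (_ * (2 * Real.pi * y)) := mul_le_mul_of_nonneg_left h2 hc
    _ = c * _ * (2 * Real.pi * y) := by ring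
    _ ≤ _ := mul_le_mul_of_nonneg_right h1 (by positivity)

lemma hsum_Ico (p q : ℕ) (h : p ≤ q) :
    ∑ i ∈ Finset.Ico p q, 1 / ((i : ℝ) + 1) = hsum q - hsum p := by
  rw [Finset.sum_Ico_eq_sub _ h]; rfl

lemma integral_lower {A Λ N M K : ℕ} (hA : A = M ^ 8) (hΛ : Λ = M ^ 9) (hMK : M = 12 * K)
    (hK : 2 ≤ K) (hN : A + Λ * A ≤ N)
    (σ : ℕ → ℕ) (hσ : Set.BijOn σ (Set.Icc 1 N) (Set.Icc 1 N))
    (hm : MonotoneOn (fun k => slope' Λ (σ k)) (Set.Icc 1 N)) (c : ℝ) (hc : 0 ≤ c)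
    (hD : 0 ≤ hsum A / 2 - (3 / 2 + Real.log M)) :
    (c * (hsum A / 2 - (3 / 2 + Real.log M)) / (4 * Real.pi)) ^ 2 *
      (hsum (K * A) - hsum (2 * A)) ≤ ∫ x in (0:ℝ)..1, ‖Tmax N σ (extr A Λ c) x‖ ^ 2 := by
  set D := hsum A / 2 - (3 / 2 + Real.log M) with hDdef
  have hM24 : 24 ≤ M := by omega
  have hA1 : 1 ≤ A := by rw [hA]; exact Nat.one_le_pow _ _ (by omega)
  have hΛA : Λ = M * A := by rw [hA, hΛ]; ring
  have hAΛ : A < Λ := by rw [hΛA]; nlinarith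
  have hMA : M ≤ A := by rw [hA]; exact Nat.le_self_pow (by norm_num) M
  have hN1 : 1 ≤ N := by omega
  set g : ℝ → ℝ := fun x => ‖Tmax N σ (extr A Λ c) x‖ ^ 2 with hg
  have hgc : Continuous g := (Tmax_continuous N hN1 σ _).norm.pow 2
  have hg0 : ∀ x, 0 ≤ g x := fun x => by positivity
  have hgi : ∀ a b : ℝ, IntervalIntegrable g volume a b := fun a b => hgc.intervalIntegrable _ _
  have hpi := Real.pi_pos
  have hΛ0 : (0:ℝ) < Λ := by exact_mod_cast (lt_of_le_of_lt (Nat.zero_le _) hAΛ)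
  have hM0 : (0:ℝ) < M := by exact_mod_cast (show 0 < M by omega)
  have hA0 : (0:ℝ) < A := by exact_mod_cast hA1
  have hΛr : (Λ:ℝ) = M * A := by exact_mod_cast hΛA
  have hMr : (M:ℝ) = 12 * K := by exact_mod_cast hMK
  have hΛ4 : (4:ℝ) ≤ Λ := by exact_mod_cast (show 4 ≤ Λ by omega)
  have hpiece : ∀ i ∈ Finset.Ico (2 * A) (K * A), (c * D / (4 * Real.pi)) ^ 2 * (1 / ((i:ℝ) + 1)) ≤
      ∫ x in ((i:ℝ) / Λ)..(((i + 1 : ℕ) : ℝ) / Λ), g x := by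
    intro i hi
    have hi := Finset.mem_Ico.1 hi
    set J : ℝ := (i:ℝ) + 1 with hJ
    have hJ0 : 0 < J := by positivity
    have hJlo : 2 * (A:ℝ) ≤ J := by
      have : (2 * A : ℝ) ≤ i := by exact_mod_cast hi.1
      linarith
    have hJhi : J ≤ K * A := by
      have : ((i + 1 : ℕ) : ℝ) ≤ (K * A : ℕ) := by exact_mod_cast hi.2
      push_cast at this; exact this
    have hJΛ : J / Λ ≤ 1 / 12 := by
      rw [div_le_iff₀ hΛ0, hΛr, hMr]; linarith
    have hJΛ2 : 2 / M ≤ J / Λ := by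
      rw [div_le_div_iff₀ hM0 hΛ0, hΛr]; nlinarith
    have hJΛ0 : 0 < J / Λ := by positivity
    set u : ℝ := (J - 2 * (J / Λ)) / Λ with hu
    set v : ℝ := (J - J / Λ) / Λ with hv
    have huv : u ≤ v := by rw [hu, hv]; gcongr; linarith
    have hiu : (i:ℝ) / Λ ≤ u := by rw [hu]; gcongr; linarith
    have hvi : v ≤ ((i + 1 : ℕ) : ℝ) / Λ := by
      rw [hv]; push_cast; gcongr; linarith
    have hvol : v - u = J / Λ ^ 2 := by rw [hu, hv]; field_simp; ring
    have hpt : ∀ x ∈ Set.Icc u v, (c * D * Λ / (4 * Real.pi * J)) ^ 2 ≤ g x := by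
      intro x hx
      have hx1 : J - 2 * (J / Λ) ≤ x * Λ := (div_le_iff₀ hΛ0).1 hx.1
      have hx2 : x * Λ ≤ J - J / Λ := (le_div_iff₀ hΛ0).1 hx.2
      have hylo : J / Λ ≤ J - Λ * x := by linarith
      have hyhi : J - Λ * x ≤ 2 * (J / Λ) := by linarith
      have hxJ : x ≤ J / Λ := by rw [le_div_iff₀ hΛ0]; linarith
      have hxM : 1 / (M:ℝ) ≤ x := by
        refine le_trans ?_ hx.1
        have e : u = J / Λ * (1 - 2 / Λ) := by rw [hu]; field_simp
        have h2 : 1 / 2 ≤ 1 - 2 / (Λ:ℝ) := by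
          have : 2 / (Λ:ℝ) ≤ 1 / 2 := by rw [div_le_div_iff₀ hΛ0 (by norm_num)]; linarith
          linarith
        rw [e]
        calc 1 / (M:ℝ) = 2 / M * (1 / 2) := by ring
          _ ≤ _ := mul_le_mul hJΛ2 h2 (by norm_num) hJΛ0.le
      have hp := pointwise hAΛ hN (by omega) hMA σ hσ hm c hc x (J - Λ * x) (i + 1)
        (by rw [hJ]; push_cast; ring) (by linarith) (by linarith) hxM (by linarith)
      have hT := Tmax_nonneg N σ (extr A Λ c) x
      have h5 : c * D ≤ Tmax N σ (extr A Λ c) x * (2 * Real.pi * (2 * (J / Λ))) := by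
        refine hp.trans ?_
        gcongr
      have h6 : c * D * Λ / (4 * Real.pi * J) ≤ Tmax N σ (extr A Λ c) x := by
        rw [div_le_iff₀ (by positivity)]
        have := mul_le_mul_of_nonneg_right h5 hΛ0.le
        refine this.trans (le_of_eq ?_)
        field_simp; ring
      have h7 : 0 ≤ c * D * Λ / (4 * Real.pi * J) := by positivity
      simp only [hg]
      rw [Real.norm_eq_abs, sq_abs]
      gcongr
    have h8 : (v - u) * (c * D * Λ / (4 * Real.pi * J)) ^ 2 ≤ ∫ x in u..v, g x := by
      have := intervalIntegral.integral_mono_on huv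
        (intervalIntegrable_const (c := (c * D * Λ / (4 * Real.pi * J)) ^ 2)) (hgi u v) hpt
      simpa using this
    have h9 : ∫ x in u..v, g x ≤ ∫ x in ((i:ℝ) / Λ)..(((i + 1 : ℕ) : ℝ) / Λ), g x :=
      intervalIntegral.integral_mono_interval hiu huv hvi
        (Eventually.of_forall hg0) (hgi _ _)
    refine le_trans (le_of_eq ?_) (h8.trans h9)
    rw [hvol]; field_simp
  have hAK : 2 * A ≤ K * A := Nat.mul_le_mul_right _ hK
  have hKΛ : K * A ≤ Λ := by rw [hΛA]; exact Nat.mul_le_mul_right _ (by omega)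
  rw [← hsum_Ico _ _ hAK, Finset.mul_sum]
  refine (Finset.sum_le_sum hpiece).trans ?_
  rw [intervalIntegral.sum_integral_adjacent_intervals_Ico (a := fun i : ℕ => (i:ℝ) / Λ) hAK
    (fun k _ => hgi _ _)]
  refine intervalIntegral.integral_mono_interval (by positivity) ?_ ?_
    (Eventually.of_forall hg0) (hgi _ _)
  · gcongr
  · rw [div_le_one hΛ0]; exact_mod_cast hKΛ

lemma memLp_of_continuous {f : ℝ → ℂ} (hf : Continuous f) :
    MemLp f 2 (volume.restrict (Set.Ioc (0:ℝ) 1)) := by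
  rw [memLp_two_iff_integrable_sq_norm hf.aestronglyMeasurable]
  have h : IntervalIntegrable (fun x => ‖f x‖ ^ 2) volume 0 1 :=
    (hf.norm.pow 2).intervalIntegrable _ _
  rwa [intervalIntegrable_iff_integrableOn_Ioc_of_le zero_le_one] at h

lemma log12_bounds : 1 ≤ Real.log 12 ∧ Real.log 12 ≤ 3 ∧ Real.log 2 ≤ 1 := by
  have h1 := Real.exp_one_gt_d9
  have h2 := Real.exp_one_lt_d9
  refine ⟨?_, ?_, ?_⟩
  · rw [Real.le_log_iff_exp_le (by norm_num)]; linarith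
  · rw [Real.log_le_iff_le_exp (by norm_num)]
    have : Real.exp 3 = Real.exp 1 ^ 3 := by rw [← Real.exp_nat_mul]; norm_num
    rw [this]
    have : (2.7:ℝ) ^ 3 ≤ Real.exp 1 ^ 3 := by gcongr; linarith
    norm_num at this ⊢; linarith
  · rw [Real.log_le_iff_le_exp (by norm_num)]; linarith

lemma log_pow_bound (N K : ℕ) (n : ℕ) (hN : 0 < N) (h : N < (12 * (K + 1)) ^ n) :
    Real.log N ≤ n * (Real.log 12 + Real.log ((K:ℝ) + 1)) := by
  have hN0 : (0:ℝ) < N := by exact_mod_cast hN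
  have h1 : (N:ℝ) ≤ (12 * ((K:ℝ) + 1)) ^ n := by exact_mod_cast h.le
  have h2 := Real.log_le_log hN0 h1
  rwa [Real.log_pow, Real.log_mul (by norm_num) (by positivity)] at h2

lemma log_succ_bound (K : ℕ) (hK : 1 ≤ K) : Real.log ((K:ℝ) + 1) ≤ Real.log 2 + Real.log K := by
  have hK1 : (1:ℝ) ≤ K := by exact_mod_cast hK
  have : Real.log ((K:ℝ) + 1) ≤ Real.log (2 * K) :=
    Real.log_le_log (by positivity) (by linarith)
  rwa [Real.log_mul (by norm_num) (by positivity)] at this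

lemma final_num {ℓ H c D Δ L : ℝ} (hℓ : 100 ≤ ℓ) (hH0 : 0 < H) (hH : H ≤ 9 * ℓ)
    (hc2 : c ^ 2 = 1 / H) (hD : 3 * ℓ ≤ D) (hΔ : ℓ / 2 ≤ Δ) (hL0 : 0 ≤ L) (hL : L ≤ 19 * ℓ) :
    (1 / 2000 * L) ^ 2 ≤ (c * D / (4 * Real.pi)) ^ 2 * Δ := by
  have hpi := Real.pi_pos
  have hpi2 : Real.pi ^ 2 ≤ 10 := by
    have := Real.pi_lt_d2
    nlinarith
  have h8 : ℓ / 160 ≤ (c * D / (4 * Real.pi)) ^ 2 := by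
    have e : (c * D / (4 * Real.pi)) ^ 2 = D ^ 2 / (H * (16 * Real.pi ^ 2)) := by
      rw [div_pow, mul_pow, hc2]; field_simp; norm_num
    rw [e, div_le_div_iff₀ (by norm_num) (by positivity)]
    calc ℓ * (H * (16 * Real.pi ^ 2)) ≤ ℓ * (9 * ℓ * (16 * 10)) := by gcongr
      _ = (3 * ℓ) ^ 2 * 160 := by ring
      _ ≤ _ := by gcongr
  calc (1 / 2000 * L) ^ 2 ≤ (1 / 2000 * (19 * ℓ)) ^ 2 := by gcongr
    _ ≤ ℓ / 160 * (ℓ / 2) := by nlinarith [sq_nonneg ℓ]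
    _ ≤ _ := by gcongr

lemma lower_large (N K : ℕ) (hKN : (12 * K) ^ 18 ≤ N) (hNK : N < (12 * (K + 1)) ^ 18)
    (hℓ : 100 ≤ Real.log K) :
    ∃ σ : ℕ → ℕ, Set.BijOn σ (Set.Icc 1 N) (Set.Icc 1 N) ∧
      (∃ f : ℝ → ℂ, MemLp f 2 (volume.restrict (Set.Ioc (0:ℝ) 1)) ∧ l2normT f ≤ 1 ∧
          1 / 2000 * Real.log N ≤ l2normT (Tmax N σ f)) := by
  obtain ⟨h12a, h12b, h2⟩ := log12_bounds
  have hK2 : 2 ≤ K := by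
    by_contra hlt
    have : K = 0 ∨ K = 1 := by omega
    rcases this with rfl | rfl <;> norm_num at hℓ
  set M := 12 * K with hM
  set A := M ^ 8 with hA
  set Λ := M ^ 9 with hΛ
  have hM1 : 1 ≤ M := by omega
  have hA1 : 1 ≤ A := Nat.one_le_pow _ _ hM1
  have hNle : A + Λ * A ≤ N := by
    refine le_trans ?_ hKN
    have e : Λ * A = M ^ 17 := by rw [hΛ, hA]; ring
    have e2 : M ^ 18 = M * M ^ 17 := by ring
    have e3 : A ≤ M ^ 17 := Nat.pow_le_pow_right hM1 (by norm_num)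
    rw [e, e2]; nlinarith
  have hAΛ : A < Λ := by
    have : Λ = M * A := by rw [hΛ, hA]; ring
    rw [this]; nlinarith
  have hK0 : (0:ℝ) < K := by exact_mod_cast (show 0 < K by omega)
  have hA0 : (0:ℝ) < A := by exact_mod_cast hA1
  set ℓ := Real.log K with hℓd
  have hlM : Real.log M = Real.log 12 + ℓ := by
    rw [hM]; push_cast; rw [Real.log_mul (by norm_num) hK0.ne']
  have hlA : Real.log A = 8 * Real.log M := by
    rw [hA]; push_cast; rw [Real.log_pow]; norm_num
  have hHA1 := hsum_le A
  have hHA2 := le_hsum A hA1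
  have hHA3 : hsum A ≤ 9 * ℓ := by linarith
  have hHA0 : 0 < hsum A := by linarith
  have hD : 3 * ℓ ≤ hsum A / 2 - (3 / 2 + Real.log M) := by linarith
  have hdiff : ℓ / 2 ≤ hsum (K * A) - hsum (2 * A) := by
    have h3 := le_hsum (K * A) (Nat.mul_pos (by omega) hA1)
    have h4 := hsum_le (2 * A)
    push_cast at h3 h4
    rw [Real.log_mul hK0.ne' hA0.ne'] at h3
    rw [Real.log_mul (by norm_num) hA0.ne'] at h4
    linarith
  have hN0 : 0 < N := by omega
  have hlN : Real.log N ≤ 19 * ℓ := by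
    have h7 := log_pow_bound N K 18 hN0 hNK
    have h9 := log_succ_bound K (by omega)
    push_cast at h7
    linarith
  have hlN0 : 0 ≤ Real.log N := Real.log_natCast_nonneg N
  obtain ⟨σ, hσ, hmono⟩ := exists_sorted N (slope' Λ)
  set c : ℝ := 1 / Real.sqrt (hsum A) with hc
  have hc2 : c ^ 2 = 1 / hsum A := by
    rw [hc, div_pow, one_pow, Real.sq_sqrt hHA0.le]
  refine ⟨σ, hσ, extr A Λ c, memLp_of_continuous (tpoly_continuous _ _), ?_, ?_⟩
  · apply l2normT_le zero_le_one
    rw [extr_energy hAΛ, hc2, one_pow]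
    apply le_of_eq; field_simp
  · apply le_l2normT
    refine le_trans ?_ (integral_lower hA hΛ hM hK2 hNle σ hσ hmono c (by positivity) (by linarith))
    exact final_num hℓ hHA0 hHA3 hc2 hD hdiff hlN0 hlN

lemma lower_small (N : ℕ) (hN : 1 < N) (hl : Real.log N ≤ 2000) :
    ∃ σ : ℕ → ℕ, Set.BijOn σ (Set.Icc 1 N) (Set.Icc 1 N) ∧
      (∃ f : ℝ → ℂ, MemLp f 2 (volume.restrict (Set.Ioc (0:ℝ) 1)) ∧ l2normT f ≤ 1 ∧
          1 / 2000 * Real.log N ≤ l2normT (Tmax N σ f)) := by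
  refine ⟨id, Set.bijOn_id _, tpoly {1} (fun _ => 1), memLp_of_continuous (tpoly_continuous _ _),
    ?_, ?_⟩
  · apply l2normT_le zero_le_one
    rw [tpoly_parseval]; simp
  · refine le_trans (b := 1) (by linarith) ?_
    apply le_l2normT
    have h1 : ∀ x, (1:ℝ) ≤ ‖Tmax N id (tpoly {1} (fun _ => 1)) x‖ ^ 2 := by
      intro x
      have := Tmax_ge N id (tpoly {1} (fun _ => 1)) x 1 le_rfl hN.le
      rw [Finset.Icc_self, Finset.sum_singleton, norm_mul, trigChar_norm, fourierCoef_tpoly,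
        if_pos (by simp)] at this
      simp only [norm_one, mul_one] at this
      rw [Real.norm_eq_abs, sq_abs]
      nlinarith
    have h2 := intervalIntegral.integral_mono (μ := volume) (zero_le_one (α := ℝ))
      (intervalIntegrable_const (c := (1:ℝ)))
      (((Tmax_continuous N hN.le id (tpoly {1} (fun _ => 1))).norm.pow 2).intervalIntegrable 0 1) h1
    simpa using h2

lemma lower_bound (N : ℕ) (hN : 1 < N) :
    ∃ σ : ℕ → ℕ, Set.BijOn σ (Set.Icc 1 N) (Set.Icc 1 N) ∧
      (∃ f : ℝ → ℂ, MemLp f 2 (volume.restrict (Set.Ioc (0:ℝ) 1)) ∧ l2normT f ≤ 1 ∧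
          1 / 2000 * Real.log N ≤ l2normT (Tmax N σ f)) := by
  set K := Nat.findGreatest (fun K => (12 * K) ^ 18 ≤ N) N with hK
  have h1 : (12 * K) ^ 18 ≤ N :=
    Nat.findGreatest_spec (P := fun K => (12 * K) ^ 18 ≤ N) (Nat.zero_le N) (by simp)
  have h2 : N < (12 * (K + 1)) ^ 18 := by
    by_contra hcon
    push Not at hcon
    have hle : K + 1 ≤ N := by
      refine le_trans ?_ hcon
      refine le_trans ?_ (Nat.le_self_pow (by norm_num) _)
      omega
    have := Nat.le_findGreatest (P := fun K => (12 * K) ^ 18 ≤ N) hle hcon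
    omega
  by_cases hℓ : 100 ≤ Real.log K
  · exact lower_large N K h1 h2 hℓ
  · push Not at hℓ
    apply lower_small N hN
    obtain ⟨h12a, h12b, hl2⟩ := log12_bounds
    have h4 := log_pow_bound N K 18 (by omega) h2
    push_cast at h4
    have h5 : Real.log ((K:ℝ) + 1) ≤ 101 := by
      rcases Nat.eq_zero_or_pos K with h0 | h0
      · rw [h0]; norm_num
      · have := log_succ_bound K h0
        linarith
    linarith

/-- For every `N > 1` there is a permutation `σ` of `{1,…,N}` such that
`c₁ log N ≤ ‖T_{σ,N}‖_{L²→L²} ≤ c₂ log N`. -/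
theorem statement0 :
    ∃ c₁ c₂ : ℝ, 0 < c₁ ∧ 0 < c₂ ∧ ∀ N : ℕ, 1 < N →
      ∃ σ : ℕ → ℕ, Set.BijOn σ (Set.Icc 1 N) (Set.Icc 1 N) ∧
        (∀ f : ℝ → ℂ, MemLp f 2 (volume.restrict (Set.Ioc (0:ℝ) 1)) → l2normT f ≤ 1 →
          l2normT (Tmax N σ f) ≤ c₂ * Real.log N) ∧
        (∃ f : ℝ → ℂ, MemLp f 2 (volume.restrict (Set.Ioc (0:ℝ) 1)) ∧ l2normT f ≤ 1 ∧
          c₁ * Real.log N ≤ l2normT (Tmax N σ f)) := by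
  refine ⟨1 / 2000, 3 / Real.log 2, by norm_num, ?_, ?_⟩
  · have := Real.log_pos (show (1:ℝ) < 2 by norm_num)
    positivity
  · intro N hN
    obtain ⟨σ, hσ, hf⟩ := lower_bound N hN
    exact ⟨σ, hσ, fun f hf hf1 => upper_bound N hN σ hσ f hf hf1, hf⟩
end

section
/- There exist an absolute constant c > 0 and an integer N₀ such that the following holds for every integer N > N₀. Let f(x) = (1/‖x‖)·𝟙_{B(10 N^{-9}, N^{-8})}(x) for x ∈ ℝ², and for k = 1,…,N let θ_k = πk/N. For each k let h_k ∈ L²(ℝ²) be the function whose Fourier transform satisfies 𝓕h_k = 𝟙_{Γ_{θ_k}}·𝓕f almost everywhere. Then ‖ sup_{1≤k≤N} |h_k| ‖_{L²(ℝ²)} ≥ c·(log N)·‖f‖_{L²(ℝ²)}. -/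
open MeasureTheory Real FourierTransform

/-- The Euclidean plane `ℝ²`. -/
noncomputable abbrev Plane := EuclideanSpace ℝ (Fin 2)

/-- The closed half-plane `Γ_θ = {x : x₁ cos θ + x₂ sin θ ≥ 0}`. -/
def halfPlane (θ : ℝ) : Set Plane :=
  {x | 0 ≤ x 0 * Real.cos θ + x 1 * Real.sin θ}

/-- The `L²(ℝ²)` norm. -/
noncomputable def l2norm2 {E : Type*} [NormedAddCommGroup E] (f : Plane → E) : ℝ :=
  (∫ x : Plane, ‖f x‖ ^ 2) ^ ((1:ℝ)/2)

/-- `HasFourierTransform h u` says that the (distributional/L²) Fourier transform of `h` is `u`,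
expressed through the multiplication formula `∫ h ⬝ 𝓕φ = ∫ u ⬝ φ` against Schwartz functions. -/
def HasFourierTransform (h u : Plane → ℂ) : Prop :=
  ∀ φ : SchwartzMap Plane ℂ,
    ∫ x : Plane, h x * 𝓕 (fun y => φ y) x = ∫ ξ : Plane, u ξ * φ ξ

/-- Demeter's function `f(x) = ‖x‖⁻¹ 𝟙_{B(10 N⁻⁹, N⁻⁸)}(x)`. -/
noncomputable def demeterF (N : ℕ) : Plane → ℂ := fun x =>
  if 10 * (N:ℝ) ^ (-9 : ℤ) ≤ ‖x‖ ∧ ‖x‖ < (N:ℝ) ^ (-8 : ℤ) then ((‖x‖⁻¹ : ℝ) : ℂ) else 0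


/-! ### Rotated coordinates -/

noncomputable def rotP (θ : ℝ) : Plane ≃ₗᵢ[ℝ] Plane where
  toFun x := !₂[x 0 * Real.cos θ - x 1 * Real.sin θ, x 0 * Real.sin θ + x 1 * Real.cos θ]
  invFun x := !₂[x 0 * Real.cos θ + x 1 * Real.sin θ, - x 0 * Real.sin θ + x 1 * Real.cos θ]
  map_add' x y := by
    ext i; fin_cases i <;> simp <;> ring
  map_smul' c x := by
    ext i; fin_cases i <;> simp <;> ring
  left_inv x := by
    have := Real.sin_sq_add_cos_sq θ
    ext i; fin_cases i <;> simp
    · linear_combination (x 0) * this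
    · linear_combination (x 1) * this
  right_inv x := by
    have := Real.sin_sq_add_cos_sq θ
    ext i; fin_cases i <;> simp
    · linear_combination (x 0) * this
    · linear_combination (x 1) * this
  norm_map' x := by
    have := Real.sin_sq_add_cos_sq θ
    rw [EuclideanSpace.norm_eq, EuclideanSpace.norm_eq]
    congr 1
    simp [Fin.sum_univ_two]
    linear_combination (x 0 ^ 2 + x 1 ^ 2) * this

noncomputable def chart (θ : ℝ) : ℝ × ℝ ≃ᵐ Plane :=
  ((MeasurableEquiv.finTwoArrow (α := ℝ)).symm.trans (MeasurableEquiv.toLp 2 (Fin 2 → ℝ))).trans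
    (rotP θ).toMeasurableEquiv

lemma chart_eq (θ : ℝ) (p : ℝ × ℝ) : chart θ p = rotP θ !₂[p.1, p.2] := by
  simp [chart, MeasurableEquiv.finTwoArrow]

lemma chart_mp (θ : ℝ) : MeasurePreserving (chart θ) volume volume :=
  ((rotP θ).measurePreserving).comp
    ((PiLp.volume_preserving_toLp (Fin 2)).comp (volume_preserving_finTwoArrow ℝ).symm)

lemma chart_symm_apply (θ : ℝ) (x : Plane) : (chart θ).symm x =
    (x 0 * Real.cos θ + x 1 * Real.sin θ, - x 0 * Real.sin θ + x 1 * Real.cos θ) := by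
  rw [MeasurableEquiv.symm_apply_eq, chart_eq]
  have := Real.sin_sq_add_cos_sq θ
  ext i; fin_cases i <;> simp [rotP]
  · linear_combination -(x 0) * this
  · linear_combination -(x 1) * this

lemma chart_inner (θ : ℝ) (p q : ℝ × ℝ) :
    inner ℝ (chart θ p) (chart θ q) = p.1 * q.1 + p.2 * q.2 := by
  rw [chart_eq, chart_eq, LinearIsometryEquiv.inner_map_map]
  simp [PiLp.inner_apply, Fin.sum_univ_two]
  ring

lemma chart_norm (θ : ℝ) (p : ℝ × ℝ) :
    ‖chart θ p‖ = √(p.1 ^ 2 + p.2 ^ 2) := by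
  rw [chart_eq, LinearIsometryEquiv.norm_map, EuclideanSpace.norm_eq]
  simp [Fin.sum_univ_two]

lemma chart_mem (θ : ℝ) (p : ℝ × ℝ) : chart θ p ∈ halfPlane θ ↔ 0 ≤ p.1 := by
  have h := chart_symm_apply θ (chart θ p)
  simp only [MeasurableEquiv.symm_apply_apply] at h
  have h1 := congrArg Prod.fst h
  simp only at h1
  rw [h1]
  rfl

/-! ### The one dimensional half-line computation -/

lemma half_line (g : ℝ → ℂ) (hg : Integrable g) (hG : Integrable (𝓕⁻ g)) (a r : ℝ) (har : a < r)
    (hgr : ∀ x ≤ r, g x = 0) :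
    ∫ s in Set.Ioi (0:ℝ), 𝓕⁻ g s * (𝐞 (-(a * s)) : ℂ)
      = (Complex.I / (2 * π)) * ∫ τ, g τ / ((τ - a : ℝ) : ℂ) := by
  set m : ℝ → ℂ := fun y => g (y + a) / (y : ℂ) with hm
  have hga : Integrable (fun y => g (y + a)) := hg.comp_add_right a
  have hmi : Integrable m := by
    refine (hga.norm.mul_const ((r - a)⁻¹)).mono' ?_ ?_
    · exact (hga.aestronglyMeasurable.aemeasurable.div (Complex.measurable_ofReal.aemeasurable)).aestronglyMeasurable
    · refine Filter.Eventually.of_forall fun y => ?_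
      simp only [hm, norm_div, Complex.norm_real, Real.norm_eq_abs]
      by_cases hy : y + a ≤ r
      · simp [hgr _ hy]
      · push Not at hy
        rw [div_eq_mul_inv]
        gcongr
        · exact le_trans (by linarith : r - a ≤ y) (le_abs_self y)
  have hxm : ∀ y : ℝ, (y:ℂ) * m y = g (y + a) := by
    intro y
    by_cases hy : y = 0
    · subst hy; simp [hgr a har.le]
    · have : (y:ℂ) ≠ 0 := by exact_mod_cast hy
      simp only [hm]; field_simp
  have hxmi : Integrable (fun x : ℝ => x • m x) := by
    refine hga.congr (Filter.Eventually.of_forall fun y => ?_)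
    simp [hxm]
  have hder := Real.hasDerivAt_fourier hmi hxmi
  have hF : ∀ s : ℝ, 𝓕 (fun x : ℝ => (-2 * (π:ℂ) * Complex.I * (x:ℂ)) • m x) (-s)
      = (-2 * π * Complex.I) * (𝓕⁻ g s * (𝐞 (-(a * s)) : ℂ)) := by
    intro s
    rw [Real.fourier_real_eq, Real.fourierInv_eq']
    rw [← integral_mul_const, ← integral_const_mul,
      ← integral_add_right_eq_self (fun y => (-2 * π * Complex.I) * _) a]
    congr 1; ext y
    simp only [Circle.smul_def, smul_eq_mul]
    have := hxm y
    rw [Real.fourierChar_apply, Real.fourierChar_apply, ← this]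
    have e : Complex.exp (↑(2 * π * inner ℝ (y + a) s) * Complex.I) * Complex.exp (↑(2 * π * -(a * s)) * Complex.I)
       = Complex.exp (↑(2 * π * -(y * -s)) * Complex.I) := by
      rw [← Complex.exp_add]; congr 1
      simp; ring
    rw [← e]; ring
  have hP : ∀ s ∈ Set.Ici (0:ℝ), HasDerivAt (fun s : ℝ => (1 / (2 * π * Complex.I)) * 𝓕 m (-s))
      (𝓕⁻ g s * (𝐞 (-(a * s)) : ℂ)) s := by
    intro s _
    have h1 := (hder (-s)).scomp s (hasDerivAt_neg s)
    have h2 := h1.const_mul (1 / (2 * π * Complex.I))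
    rw [hF] at h2
    convert! h2 using 1
    have : (π:ℂ) ≠ 0 := by exact_mod_cast Real.pi_ne_zero
    simp
    field_simp
    simp
  have hlim : Filter.Tendsto (fun s : ℝ => (1 / (2 * π * Complex.I)) * 𝓕 m (-s)) Filter.atTop
      (nhds ((1 / (2 * π * Complex.I)) * 0)) := by
    refine Filter.Tendsto.const_mul _ ?_
    refine (Real.zero_at_infty_fourier m).comp ?_
    exact Filter.tendsto_neg_atTop_atBot.mono_right atBot_le_cocompact
  have hIntg : IntegrableOn (fun s => 𝓕⁻ g s * (𝐞 (-(a * s)) : ℂ)) (Set.Ioi 0) := by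
    refine Integrable.integrableOn ?_
    refine hG.mono ?_ ?_
    · refine hG.aestronglyMeasurable.mul ?_
      refine Continuous.aestronglyMeasurable ?_
      fun_prop
    · refine Filter.Eventually.of_forall fun y => ?_
      rw [norm_mul, Circle.norm_coe, mul_one]
  rw [integral_Ioi_of_hasDerivAt_of_tendsto' hP hIntg hlim]
  have h0 : 𝓕 m (-0) = ∫ τ, g τ / ((τ - a : ℝ) : ℂ) := by
    rw [Real.fourier_real_eq, ← integral_add_right_eq_self (fun τ => g τ / ((τ - a : ℝ) : ℂ)) a]
    simp [hm]
  rw [h0]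
  have : (π:ℂ) ≠ 0 := by exact_mod_cast Real.pi_ne_zero
  field_simp
  simp

/-! ### Identification of the pairing with tensor product test functions -/

lemma chart_integral (θ : ℝ) (u : Plane → ℂ) : ∫ x, u x = ∫ p : ℝ × ℝ, u (chart θ p) :=
  ((chart_mp θ).integral_comp (chart θ).measurableEmbedding u).symm

lemma fourier_chart (θ : ℝ) (f : Plane → ℂ) (p : ℝ × ℝ) :
    𝓕 f (chart θ p) = ∫ q : ℝ × ℝ, f (chart θ q) *
      ((𝐞 (-(q.1 * p.1)) : ℂ) * (𝐞 (-(q.2 * p.2)) : ℂ)) := by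
  rw [Real.fourier_eq, chart_integral θ]
  congr 1; ext q
  rw [chart_inner, Circle.smul_def, smul_eq_mul, mul_comm, neg_add, AddChar.map_add_eq_mul,
    Circle.coe_mul]

lemma fourierInv_chart (θ : ℝ) (g1 g2 : ℝ → ℂ) (g : Plane → ℂ)
    (hg : ∀ p, g (chart θ p) = g1 p.1 * g2 p.2) (p : ℝ × ℝ) :
    𝓕⁻ g (chart θ p) = 𝓕⁻ g1 p.1 * 𝓕⁻ g2 p.2 := by
  rw [Real.fourierInv_eq, chart_integral θ, Real.fourierInv_eq, Real.fourierInv_eq,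
    ← integral_prod_mul]
  congr 1; ext q
  rw [chart_inner, hg]
  simp only [Circle.smul_def, smul_eq_mul, AddChar.map_add_eq_mul, Circle.coe_mul]
  simp [mul_comm]
  ring

lemma key (θ : ℝ) (f h : Plane → ℂ) (hf : Integrable f)
    (hh : HasFourierTransform h
      (fun ξ => Set.indicator (halfPlane θ) (fun _ => 1) ξ * 𝓕 f ξ))
    (g1 g2 : ℝ → ℂ) (hs1 : ContDiff ℝ (⊤ : ℕ∞) g1) (hc1 : HasCompactSupport g1)
    (hs2 : ContDiff ℝ (⊤ : ℕ∞) g2) (hc2 : HasCompactSupport g2)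
    (r : ℝ) (hgr : ∀ x ≤ r, g1 x = 0) (hfr : ∀ q : ℝ × ℝ, r ≤ q.1 → f (chart θ q) = 0) :
    ∫ p : ℝ × ℝ, h (chart θ p) * (g1 p.1 * g2 p.2) =
      (Complex.I / (2 * π)) * ∫ q : ℝ × ℝ,
        f (chart θ q) * ((∫ τ, g1 τ / ((τ - q.1 : ℝ) : ℂ)) * g2 q.2) := by
  set g : Plane → ℂ := fun x => g1 (x 0 * Real.cos θ + x 1 * Real.sin θ) *
    g2 (- x 0 * Real.sin θ + x 1 * Real.cos θ) with hgdef
  have hgc : ∀ p, g (chart θ p) = g1 p.1 * g2 p.2 := by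
    intro p
    have := chart_symm_apply θ (chart θ p)
    simp only [MeasurableEquiv.symm_apply_apply] at this
    have h1 := congrArg Prod.fst this
    have h2 := congrArg Prod.snd this
    simp only at h1 h2
    simp only [hgdef]
    rw [← h1, ← h2]
  have hgs : ContDiff ℝ (⊤ : ℕ∞) g := by
    have h0 : ∀ i : Fin 2, ContDiff ℝ (⊤ : ℕ∞) (fun x : Plane => x i) := fun i =>
      (EuclideanSpace.proj (𝕜 := ℝ) i).contDiff
    refine (hs1.comp ?_).mul (hs2.comp ?_)
    · exact ((h0 0).mul contDiff_const).add ((h0 1).mul contDiff_const)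
    · exact ((h0 0).neg.mul contDiff_const).add ((h0 1).mul contDiff_const)
  have hgcs : HasCompactSupport g := by
    have hK : IsCompact ((fun p : ℝ × ℝ => rotP θ !₂[p.1, p.2]) '' (tsupport g1 ×ˢ tsupport g2)) := by
      refine (hc1.isCompact.prod hc2.isCompact).image ?_
      refine (rotP θ).continuous.comp ?_
      fun_prop
    refine HasCompactSupport.intro hK fun x hx => ?_
    by_contra hne
    apply hx
    obtain ⟨p, rfl⟩ := (chart θ).surjective x
    rw [hgc] at hne
    refine ⟨p, ⟨subset_tsupport _ (left_ne_zero_of_mul hne), subset_tsupport _ (right_ne_zero_of_mul hne)⟩, ?_⟩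
    rw [chart_eq]
  set gS : SchwartzMap Plane ℂ := hgcs.toSchwartzMap hgs with hgS
  set s1 : SchwartzMap ℝ ℂ := hc1.toSchwartzMap hs1 with hs1'
  set s2 : SchwartzMap ℝ ℂ := hc2.toSchwartzMap hs2 with hs2'
  have e1 : (s1 : ℝ → ℂ) = g1 := by ext; simp [hs1']
  have e2 : (s2 : ℝ → ℂ) = g2 := by ext; simp [hs2']
  have eS : (gS : Plane → ℂ) = g := by ext; simp [hgS]
  have i1 : Integrable (𝓕⁻ g1) := by
    rw [← e1, ← SchwartzMap.fourierInv_coe]; exact (𝓕⁻ s1).integrable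
  have i2 : Integrable (𝓕⁻ g2) := by
    rw [← e2, ← SchwartzMap.fourierInv_coe]; exact (𝓕⁻ s2).integrable
  have inv2 : 𝓕 (𝓕⁻ g2) = g2 := by
    rw [← e2, ← SchwartzMap.fourierInv_coe, ← SchwartzMap.fourier_coe,
      FourierTransform.fourier_fourierInv_eq]
  set Φ : SchwartzMap Plane ℂ := 𝓕⁻ gS with hΦ
  have hpair := hh Φ
  have eF : 𝓕 (fun y : Plane => Φ y) = g := by
    change 𝓕 (⇑Φ) = g
    rw [hΦ, ← SchwartzMap.fourier_coe, FourierTransform.fourier_fourierInv_eq, eS]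
  rw [eF, chart_integral θ, chart_integral θ] at hpair
  simp only [hgc] at hpair
  rw [hpair]
  have hFi : Integrable (fun q : ℝ × ℝ => f (chart θ q)) :=
    (chart_mp θ).integrable_comp_of_integrable hf
  set K : ℝ × ℝ → ℂ := fun p => Set.indicator (Set.Ici (0:ℝ)) (𝓕⁻ g1) p.1 * 𝓕⁻ g2 p.2 with hK
  have hKi : Integrable K := (i1.indicator measurableSet_Ici).mul_prod i2
  have step1 : ∀ p : ℝ × ℝ, (Set.indicator (halfPlane θ) (fun _ => (1:ℂ)) (chart θ p) *
      𝓕 f (chart θ p)) * Φ (chart θ p) =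
      ∫ q : ℝ × ℝ, K p * (f (chart θ q) * ((𝐞 (-(q.1 * p.1)) : ℂ) * (𝐞 (-(q.2 * p.2)) : ℂ))) := by
    intro p
    rw [integral_const_mul, ← fourier_chart, hΦ, SchwartzMap.fourierInv_coe, eS,
      fourierInv_chart θ g1 g2 g hgc]
    simp only [hK, Set.indicator, chart_mem, Set.mem_Ici]
    split_ifs <;> ring
  simp_rw [step1]
  rw [integral_integral_swap]
  swap
  · refine (hKi.mul_prod hFi).mono ?_ ?_
    · have : Function.uncurry (fun (p q : ℝ × ℝ) => K p * (f (chart θ q) * ((𝐞 (-(q.1 * p.1)) : ℂ) * (𝐞 (-(q.2 * p.2)) : ℂ))))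
        = fun z : (ℝ × ℝ) × (ℝ × ℝ) => (K z.1 * f (chart θ z.2)) * ((𝐞 (-(z.2.1 * z.1.1)) : ℂ) * (𝐞 (-(z.2.2 * z.1.2)) : ℂ)) := by
        ext z; simp [Function.uncurry]; ring
      rw [this]
      refine (hKi.mul_prod hFi).aestronglyMeasurable.mul ?_
      refine Continuous.aestronglyMeasurable ?_
      fun_prop
    · refine Filter.Eventually.of_forall fun z => ?_
      simp only [Function.uncurry, norm_mul, Circle.norm_coe, mul_one]
      exact le_rfl
  rw [← integral_const_mul]
  congr 1; ext q
  have e3 : ∀ p : ℝ × ℝ, K p * (f (chart θ q) * ((𝐞 (-(q.1 * p.1)) : ℂ) * (𝐞 (-(q.2 * p.2)) : ℂ)))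
      = f (chart θ q) * ((Set.indicator (Set.Ici (0:ℝ)) (fun s => 𝓕⁻ g1 s * (𝐞 (-(q.1 * s)) : ℂ)) p.1) *
        ((𝐞 (-(p.2 * q.2)) : ℂ) * 𝓕⁻ g2 p.2)) := by
    intro p
    rw [mul_comm p.2 q.2]
    simp only [hK, Set.indicator]
    split_ifs <;> ring
  simp_rw [e3]
  rw [integral_const_mul, Measure.volume_eq_prod, integral_prod_mul
    (Set.indicator (Set.Ici (0:ℝ)) (fun s => 𝓕⁻ g1 s * (𝐞 (-(q.1 * s)) : ℂ)))
    (fun t => (𝐞 (-(t * q.2)) : ℂ) * 𝓕⁻ g2 t), integral_indicator measurableSet_Ici,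
    integral_Ici_eq_integral_Ioi]
  have e4 : ∫ t : ℝ, (𝐞 (-(t * q.2)) : ℂ) * 𝓕⁻ g2 t = g2 q.2 := by
    conv_rhs => rw [← inv2]
    rw [Real.fourier_real_eq]
    rfl
  rw [e4]
  by_cases hq : r ≤ q.1
  · simp [hfr q hq]
  · push Not at hq
    rw [half_line g1 (by rw [← e1]; exact s1.integrable) i1 q.1 r hq hgr]
    ring

/-! ### Lower bound for the explicit integral -/

noncomputable def prof (r0 R t : ℝ) : ℝ := if r0 ≤ t ∧ t < R then t⁻¹ else 0

lemma prof_nonneg {r0 R t : ℝ} (h0 : 0 < r0) : 0 ≤ prof r0 R t := by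
  unfold prof; split_ifs with h
  · exact inv_nonneg.2 (h0.le.trans h.1)
  · exact le_rfl

lemma prof_meas (r0 R : ℝ) : Measurable (prof r0 R) := by
  unfold prof
  refine Measurable.ite ?_ measurable_inv measurable_const
  exact measurableSet_Ico

lemma demeter_prof (N : ℕ) (x : Plane) :
    demeterF N x = ((prof (10 * (N:ℝ) ^ (-9 : ℤ)) ((N:ℝ) ^ (-8 : ℤ)) ‖x‖ : ℝ) : ℂ) := by
  unfold demeterF prof
  split_ifs <;> simp

lemma prof_integrable {r0 R : ℝ} (h0 : 0 < r0) :
    Integrable (fun x : Plane => prof r0 R ‖x‖) := by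
  have h1 : Integrable (Set.indicator (Metric.ball (0 : Plane) R) (fun _ => r0⁻¹)) := by
    rw [integrable_indicator_iff measurableSet_ball]
    exact integrableOn_const (measure_ball_lt_top.ne)
  refine h1.mono' ((prof_meas r0 R).comp measurable_norm).aestronglyMeasurable ?_
  refine Filter.Eventually.of_forall fun x => ?_
  rw [Real.norm_eq_abs, abs_of_nonneg (prof_nonneg h0)]
  unfold prof
  simp only [Set.indicator, Metric.mem_ball, dist_zero_right]
  by_cases hx : ‖x‖ < R
  · simp only [hx, and_true, if_true]
    split_ifs with h
    · exact inv_anti₀ h0 h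
    · positivity
  · simp [hx]

lemma X_lower (r0 R α ρ w : ℝ) (h0 : 0 < r0) (hα : r0 ≤ α) (hαR : α ≤ R / 2)
    (hw : 0 < w) (hwα : w / 2 ≤ α) (hρ : 4 * R ≤ ρ)
    (b1 b2 : ℝ → ℝ) (hb1 : Continuous b1) (hb1c : HasCompactSupport b1)
    (hb1n : ∀ x, 0 ≤ b1 x)
    (hb1z : ∀ x, x ∉ Set.Ioo (ρ / 2) (3 * ρ / 2) → b1 x = 0)
    (hb1o : ∀ x ∈ Set.Icc (3 * ρ / 4) (5 * ρ / 4), 1 ≤ b1 x)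
    (hb2 : Continuous b2) (hb2n : ∀ x, 0 ≤ b2 x) (hb2l : ∀ x, b2 x ≤ 1)
    (hb2o : ∀ x ∈ Set.Icc (-(w / 2)) (w / 2), 1 ≤ b2 x)
    (θ : ℝ) :
    w / 8 * Real.log (R / 2 / α) ≤
      ∫ q : ℝ × ℝ, prof r0 R ‖chart θ q‖ * ((∫ τ, b1 τ / (τ - q.1)) * b2 q.2) := by
  have hα0 : 0 < α := h0.trans_le hα
  have hR : 0 < R := by linarith
  have hρ0 : 0 < ρ := by linarith
  have hb1i : Integrable b1 := hb1.integrable_of_hasCompactSupport hb1c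
  have hb1I : ρ / 2 ≤ ∫ τ, b1 τ := by
    have : ∫ τ, Set.indicator (Set.Icc (3 * ρ / 4) (5 * ρ / 4)) (fun _ => (1:ℝ)) τ ≤ ∫ τ, b1 τ := by
      refine integral_mono ?_ hb1i ?_
      · rw [integrable_indicator_iff measurableSet_Icc]
        exact integrableOn_const (by simp)
      · intro x
        simp only [Set.indicator]
        split_ifs with h
        · exact hb1o x h
        · exact hb1n x
    rw [integral_indicator measurableSet_Icc] at this
    simp at this
    linarith [this.1]
  -- pointwise facts about the inner integrand
  have hpt : ∀ a ≤ R, ∀ τ, 0 ≤ b1 τ / (τ - a) ∧ b1 τ / (τ - a) ≤ b1 τ * R⁻¹ := by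
    intro a ha τ
    by_cases hτ : τ ∈ Set.Ioo (ρ / 2) (3 * ρ / 2)
    · have : R ≤ τ - a := by have := hτ.1; linarith
      refine ⟨div_nonneg (hb1n τ) (by linarith), ?_⟩
      rw [div_eq_mul_inv]
      exact mul_le_mul_of_nonneg_left (inv_anti₀ hR this) (hb1n τ)
    · simp [hb1z τ hτ]
  have hmi : ∀ a ≤ R, Integrable (fun τ => b1 τ / (τ - a)) := by
    intro a ha
    refine (hb1i.mul_const R⁻¹).mono' ?_ ?_
    · exact (hb1.measurable.div (measurable_id.sub_const a)).aestronglyMeasurable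
    · refine Filter.Eventually.of_forall fun τ => ?_
      rw [Real.norm_eq_abs, abs_of_nonneg (hpt a ha τ).1]
      exact (hpt a ha τ).2
  set m : ℝ → ℝ := fun a => ∫ τ, b1 τ / (τ - a) with hm
  have hmmeas : StronglyMeasurable m := by
    have : Measurable (fun z : ℝ × ℝ => b1 z.2 / (z.2 - z.1)) :=
      (hb1.measurable.comp measurable_snd).div (measurable_snd.sub measurable_fst)
    exact this.stronglyMeasurable.integral_prod_right'
  have hm0 : ∀ a ≤ R, 0 ≤ m a := fun a ha => integral_nonneg fun τ => (hpt a ha τ).1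
  have hmu : ∀ a ≤ R, m a ≤ (∫ τ, b1 τ) * R⁻¹ := by
    intro a ha
    rw [← integral_mul_const]
    exact integral_mono (hmi a ha) (hb1i.mul_const _) fun τ => (hpt a ha τ).2
  have hml : ∀ a, 0 ≤ a → a ≤ R → 1 / 4 ≤ m a := by
    intro a ha0 ha
    have h1 : ∫ τ, b1 τ * (3 * ρ / 2)⁻¹ ≤ m a := by
      refine integral_mono (hb1i.mul_const _) (hmi a ha) fun τ => ?_
      by_cases hτ : τ ∈ Set.Ioo (ρ / 2) (3 * ρ / 2)
      · simp only [div_eq_mul_inv (b1 τ)]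
        refine mul_le_mul_of_nonneg_left (inv_anti₀ ?_ ?_) (hb1n τ)
        · have := hτ.1; linarith
        · have := hτ.2; linarith
      · simp [hb1z τ hτ]
    rw [integral_mul_const] at h1
    refine le_trans ?_ h1
    rw [← div_eq_mul_inv, le_div_iff₀ (by positivity)]
    linarith
  -- support
  have hsupp : ∀ q : ℝ × ℝ, R < q.1 → prof r0 R ‖chart θ q‖ = 0 := by
    intro q hq
    rw [prof, if_neg]
    rintro ⟨-, h2⟩
    rw [chart_norm] at h2
    have : q.1 ≤ √(q.1 ^ 2 + q.2 ^ 2) := Real.le_sqrt_of_sq_le (by nlinarith [sq_nonneg q.2])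
    linarith
  have hPi : Integrable (fun q : ℝ × ℝ => prof r0 R ‖chart θ q‖) :=
    (chart_mp θ).integrable_comp_of_integrable (prof_integrable h0)
  have hXi : Integrable (fun q : ℝ × ℝ => prof r0 R ‖chart θ q‖ * (m q.1 * b2 q.2)) := by
    refine (hPi.mul_const ((∫ τ, b1 τ) * R⁻¹)).mono' ?_ ?_
    · refine hPi.aestronglyMeasurable.mul ?_
      exact ((hmmeas.comp_measurable measurable_fst).mul
        (hb2.stronglyMeasurable.comp_measurable measurable_snd)).aestronglyMeasurable
    · refine Filter.Eventually.of_forall fun q => ?_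
      by_cases hq : R < q.1
      · simp [hsupp q hq]
      · push Not at hq
        have hp := prof_nonneg (R := R) (t := ‖chart θ q‖) h0
        have h1 := hm0 _ hq
        have h2 := hmu _ hq
        rw [Real.norm_eq_abs, abs_of_nonneg (mul_nonneg hp (mul_nonneg h1 (hb2n _)))]
        refine mul_le_mul_of_nonneg_left ?_ hp
        exact (mul_le_of_le_one_right h1 (hb2l _)).trans h2
  set A : ℝ → ℝ := Set.indicator (Set.Icc α (R / 2)) (fun a => 1 / 8 * (1 / a)) with hA
  set B : ℝ → ℝ := Set.indicator (Set.Icc (-(w / 2)) (w / 2)) (fun _ => 1) with hB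
  have hAi : Integrable A := by
    rw [hA, integrable_indicator_iff measurableSet_Icc]
    refine ContinuousOn.integrableOn_Icc ?_
    refine continuousOn_const.mul (continuousOn_const.div continuousOn_id ?_)
    intro x hx
    exact (hα0.trans_le hx.1).ne'
  have hBi : Integrable B := by
    rw [hB, integrable_indicator_iff measurableSet_Icc]
    exact integrableOn_const (by simp)
  have hAI : ∫ a, A a = 1 / 8 * Real.log (R / 2 / α) := by
    rw [hA, integral_indicator measurableSet_Icc, integral_Icc_eq_integral_Ioc,
      ← intervalIntegral.integral_of_le hαR, intervalIntegral.integral_const_mul,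
      integral_one_div_of_pos hα0 (by linarith)]
  have hBI : ∫ b, B b = w := by
    rw [hB, integral_indicator measurableSet_Icc]
    simp [hw.le]
  have hY : ∫ q : ℝ × ℝ, A q.1 * B q.2 = w / 8 * Real.log (R / 2 / α) := by
    rw [Measure.volume_eq_prod, integral_prod_mul A B, hAI, hBI]; ring
  rw [← hY]
  refine integral_mono (hAi.mul_prod hBi) hXi fun q => ?_
  have hpos : 0 ≤ prof r0 R ‖chart θ q‖ * (m q.1 * b2 q.2) := by
    by_cases hq : R < q.1
    · simp [hsupp q hq]
    · push Not at hq
      exact mul_nonneg (prof_nonneg h0) (mul_nonneg (hm0 _ hq) (hb2n _))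
  by_cases ha : q.1 ∈ Set.Icc α (R / 2)
  swap
  · simpa [hA, Set.indicator_of_notMem ha] using hpos
  by_cases hb : q.2 ∈ Set.Icc (-(w / 2)) (w / 2)
  swap
  · simpa [hB, Set.indicator_of_notMem hb] using hpos
  simp only [hA, hB, Set.indicator_of_mem ha, Set.indicator_of_mem hb]
  obtain ⟨ha1, ha2⟩ := ha
  have hq0 : 0 < q.1 := hα0.trans_le ha1
  have hbb : q.2 ^ 2 ≤ q.1 ^ 2 := by
    have h1 := hb.1
    have h2 := hb.2
    exact sq_le_sq' (by linarith) (by linarith)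
  have hn1 : q.1 ≤ ‖chart θ q‖ := by
    rw [chart_norm]; exact Real.le_sqrt_of_sq_le (by nlinarith [sq_nonneg q.2])
  have hn2 : ‖chart θ q‖ ≤ 2 * q.1 := by
    rw [chart_norm]; exact Real.sqrt_le_iff.2 ⟨by linarith, by nlinarith⟩
  have hn3 : ‖chart θ q‖ < R := by
    rw [chart_norm, Real.sqrt_lt' hR]; nlinarith
  have hp : (2 * q.1)⁻¹ ≤ prof r0 R ‖chart θ q‖ := by
    rw [prof, if_pos ⟨(hα.trans ha1).trans hn1, hn3⟩]
    exact inv_anti₀ (hq0.trans_le hn1) hn2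
  have h1 : 1 / 4 * 1 ≤ m q.1 * b2 q.2 :=
    mul_le_mul (hml _ hq0.le (by linarith)) (hb2o _ hb) (by norm_num) (hm0 _ (by linarith))
  calc 1 / 8 * (1 / q.1) * 1 = (2 * q.1)⁻¹ * (1 / 4 * 1) := by field_simp; norm_num
    _ ≤ _ := mul_le_mul hp h1 (by norm_num) (prof_nonneg h0)

/-! ### Lower bound for `h` on a box -/

lemma cs_finite {Ω : Type*} [MeasurableSpace Ω] (μ : Measure Ω) [IsFiniteMeasure μ] (u : Ω → ℝ)
    (hV : 0 < μ.real Set.univ) (hu : Integrable u μ) (hu2 : Integrable (fun x => u x ^ 2) μ) :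
    (∫ x, u x ∂μ) ^ 2 ≤ μ.real Set.univ * ∫ x, u x ^ 2 ∂μ := by
  set V := μ.real Set.univ with hVd
  set c := (∫ x, u x ∂μ) / V with hc
  have h1 : 0 ≤ ∫ x, (u x - c) ^ 2 ∂μ := integral_nonneg fun x => sq_nonneg _
  have h2 : ∫ x, (u x - c) ^ 2 ∂μ = (∫ x, u x ^ 2 ∂μ) - 2 * c * (∫ x, u x ∂μ) + c ^ 2 * V := by
    have : ∀ x, (u x - c) ^ 2 = u x ^ 2 - 2 * c * u x + c ^ 2 := fun x => by ring
    simp_rw [this]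
    have hi : Integrable (fun x => u x ^ 2 - 2 * c * u x) μ := hu2.sub (hu.const_mul _)
    rw [integral_add hi (integrable_const _),
      integral_sub hu2 (hu.const_mul _), integral_const_mul, integral_const, smul_eq_mul]
    ring
  rw [h2] at h1
  have h3 : ∫ x, u x ∂μ = c * V := by rw [hc]; field_simp
  rw [h3] at h1 ⊢
  nlinarith

def boxS (ρ w : ℝ) : Set (ℝ × ℝ) := Set.Ioo (ρ / 2) (3 * ρ / 2) ×ˢ Set.Ioo (-w) w

def boxQ (θ ρ w : ℝ) : Set Plane := (chart θ).symm ⁻¹' (boxS ρ w)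

lemma boxS_meas (ρ w : ℝ) : MeasurableSet (boxS ρ w) := measurableSet_Ioo.prod measurableSet_Ioo

lemma boxQ_meas (θ ρ w : ℝ) : MeasurableSet (boxQ θ ρ w) :=
  (chart θ).symm.measurable (boxS_meas ρ w)

lemma box_lower (N : ℕ) (θ : ℝ) (h : Plane → ℂ) (hL : MemLp h 2 (volume : Measure Plane))
    (hh : HasFourierTransform h
      (fun ξ => Set.indicator (halfPlane θ) (fun _ => 1) ξ * 𝓕 (demeterF N) ξ))
    (r0 R α ρ w : ℝ) (hr0 : r0 = 10 * (N:ℝ) ^ (-9 : ℤ)) (hRN : R = (N:ℝ) ^ (-8 : ℤ))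
    (h0 : 0 < r0) (hα : r0 ≤ α) (hαR : α ≤ R / 2)
    (hw : 0 < w) (hwα : w / 2 ≤ α) (hρ : 4 * R ≤ ρ) :
    (w / (16 * π) * Real.log (R / 2 / α)) ^ 2 ≤
      (2 * ρ * w) * ∫ x in boxQ θ ρ w, ‖h x‖ ^ 2 := by
  have hα0 : 0 < α := h0.trans_le hα
  have hR : 0 < R := by linarith
  have hρ0 : 0 < ρ := by linarith
  let B1 : ContDiffBump ρ := ⟨ρ / 4, ρ / 2, by linarith, by linarith⟩
  let B2 : ContDiffBump (0:ℝ) := ⟨w / 2, w, by linarith, by linarith⟩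
  have hb1z : ∀ x, x ∉ Set.Ioo (ρ / 2) (3 * ρ / 2) → B1 x = 0 := by
    intro x hx
    apply B1.zero_of_le_dist
    rw [Real.dist_eq]
    change ρ / 2 ≤ _
    by_contra hlt
    push Not at hlt
    rw [abs_lt] at hlt
    exact hx ⟨by linarith, by linarith⟩
  have hb2z : ∀ x, x ∉ Set.Ioo (-w) w → B2 x = 0 := by
    intro x hx
    apply B2.zero_of_le_dist
    rw [Real.dist_eq]
    change w ≤ _
    by_contra hlt
    push Not at hlt
    rw [abs_lt] at hlt
    exact hx ⟨by linarith, by linarith⟩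
  have hb1o : ∀ x ∈ Set.Icc (3 * ρ / 4) (5 * ρ / 4), 1 ≤ B1 x := by
    intro x hx
    refine (B1.one_of_mem_closedBall ?_).ge
    rw [Metric.mem_closedBall, Real.dist_eq]
    change _ ≤ ρ / 4
    rw [abs_le]
    exact ⟨by linarith [hx.1], by linarith [hx.2]⟩
  have hb2o : ∀ x ∈ Set.Icc (-(w / 2)) (w / 2), 1 ≤ B2 x := by
    intro x hx
    refine (B2.one_of_mem_closedBall ?_).ge
    rw [Metric.mem_closedBall, Real.dist_eq]
    change _ ≤ w / 2
    rw [abs_le]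
    exact ⟨by linarith [hx.1], by linarith [hx.2]⟩
  have hX := X_lower r0 R α ρ w h0 hα hαR hw hwα hρ B1 B2 B1.continuous B1.hasCompactSupport
    (fun x => B1.nonneg) hb1z hb1o B2.continuous (fun x => B2.nonneg) (fun x => B2.le_one) hb2o θ
  have hfi : Integrable (demeterF N) := by
    have := (prof_integrable (R := R) h0).ofReal (𝕜 := ℂ)
    refine this.congr (Filter.Eventually.of_forall fun x => ?_)
    simp only [demeter_prof, hr0, hRN]
    rfl
  have hprof : ∀ q, demeterF N (chart θ q) = ((prof r0 R ‖chart θ q‖ : ℝ) : ℂ) := by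
    intro q; rw [demeter_prof, hr0, hRN]
  have hk := key θ (demeterF N) h hfi hh (fun x => (B1 x : ℂ)) (fun x => (B2 x : ℂ))
    (Complex.ofRealCLM.contDiff.comp B1.contDiff) (B1.hasCompactSupport.comp_left (g := fun x : ℝ => (x : ℂ)) (by simp))
    (Complex.ofRealCLM.contDiff.comp B2.contDiff) (B2.hasCompactSupport.comp_left (g := fun x : ℝ => (x : ℂ)) (by simp))
    R (by
      intro x hx
      rw [hb1z x, Complex.ofReal_zero]
      intro hx'
      linarith [hx'.1]) (by
      intro q hq
      rw [hprof, prof, if_neg, Complex.ofReal_zero]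
      rintro ⟨-, h2⟩
      rw [chart_norm] at h2
      have : q.1 ≤ √(q.1 ^ 2 + q.2 ^ 2) := Real.le_sqrt_of_sq_le (by nlinarith [sq_nonneg q.2])
      linarith)
  have hXc : ∫ q : ℝ × ℝ, demeterF N (chart θ q) *
      ((∫ τ, (B1 τ : ℂ) / ((τ - q.1 : ℝ) : ℂ)) * (B2 q.2 : ℂ)) =
      ((∫ q : ℝ × ℝ, prof r0 R ‖chart θ q‖ * ((∫ τ, B1 τ / (τ - q.1)) * B2 q.2) : ℝ) : ℂ) := by
    rw [← integral_complex_ofReal]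
    congr 1; ext q
    rw [hprof]
    simp only [Complex.ofReal_mul, ← integral_complex_ofReal, Complex.ofReal_div]
  rw [hXc] at hk
  set X := ∫ q : ℝ × ℝ, prof r0 R ‖chart θ q‖ * ((∫ τ, B1 τ / (τ - q.1)) * B2 q.2) with hXdef
  have hlog : 0 ≤ Real.log (R / 2 / α) := by
    apply Real.log_nonneg
    rw [le_div_iff₀ hα0]; linarith
  have hX0 : 0 ≤ X := le_trans (by positivity) hX
  have hnorm : w / (16 * π) * Real.log (R / 2 / α) ≤
      ‖∫ p : ℝ × ℝ, h (chart θ p) * ((B1 p.1 : ℂ) * (B2 p.2 : ℂ))‖ := by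
    rw [hk, norm_mul, norm_div, Complex.norm_I, Complex.norm_real, Real.norm_eq_abs, abs_of_nonneg hX0]
    have : ‖(2 * π : ℂ)‖ = 2 * π := by
      rw [norm_mul, Complex.norm_real, Real.norm_eq_abs, abs_of_pos Real.pi_pos]; simp
    rw [this]
    calc w / (16 * π) * Real.log (R / 2 / α) = 1 / (2 * π) * (w / 8 * Real.log (R / 2 / α)) := by
          field_simp; ring
      _ ≤ _ := by gcongr
  -- Cauchy-Schwarz on the box
  have hfin : volume (boxS ρ w) < ⊤ := by
    rw [boxS, Measure.volume_eq_prod, Measure.prod_prod]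
    simp [ENNReal.mul_lt_top]
  have : IsFiniteMeasure (volume.restrict (boxS ρ w)) := ⟨by simpa using hfin⟩
  have hV : (volume.restrict (boxS ρ w)).real Set.univ = 2 * ρ * w := by
    rw [measureReal_restrict_apply_univ, boxS, Measure.volume_eq_prod, measureReal_prod_prod]
    simp only [Real.volume_real_Ioo]
    rw [max_eq_left (by linarith), max_eq_left (by linarith)]
    ring
  have hL' : MemLp (fun p => h (chart θ p)) 2 (volume : Measure (ℝ × ℝ)) :=
    hL.comp_measurePreserving (chart_mp θ)
  have hLr : MemLp (fun p => h (chart θ p)) 2 (volume.restrict (boxS ρ w)) := hL'.restrict _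
  have hi1 : Integrable (fun p => ‖h (chart θ p)‖) (volume.restrict (boxS ρ w)) :=
    (hLr.integrable (by norm_num)).norm
  have hi2 : Integrable (fun p => ‖h (chart θ p)‖ ^ 2) (volume.restrict (boxS ρ w)) :=
    hLr.integrable_norm_pow (by norm_num)
  have hcs := cs_finite (volume.restrict (boxS ρ w)) _ (by rw [hV]; positivity) hi1 hi2
  rw [hV] at hcs
  have hle : ‖∫ p : ℝ × ℝ, h (chart θ p) * ((B1 p.1 : ℂ) * (B2 p.2 : ℂ))‖ ≤
      ∫ p in boxS ρ w, ‖h (chart θ p)‖ := by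
    rw [← integral_indicator (boxS_meas ρ w)]
    refine norm_integral_le_of_norm_le ((integrable_indicator_iff (boxS_meas ρ w)).2 hi1) ?_
    refine Filter.Eventually.of_forall fun p => ?_
    by_cases hp : p ∈ boxS ρ w
    · rw [Set.indicator_of_mem hp, norm_mul, norm_mul, Complex.norm_real, Complex.norm_real,
        Real.norm_eq_abs, Real.norm_eq_abs, abs_of_nonneg B1.nonneg, abs_of_nonneg B2.nonneg]
      refine mul_le_of_le_one_right (norm_nonneg _) ?_
      exact mul_le_one₀ B1.le_one B2.nonneg B2.le_one
    · rw [Set.indicator_of_notMem hp]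
      have : p.1 ∉ Set.Ioo (ρ / 2) (3 * ρ / 2) ∨ p.2 ∉ Set.Ioo (-w) w := by
        by_contra hcon
        push Not at hcon
        exact hp hcon
      rcases this with h1 | h1
      · simp [hb1z _ h1]
      · simp [hb2z _ h1]
  have htr : ∫ x in boxQ θ ρ w, ‖h x‖ ^ 2 = ∫ p in boxS ρ w, ‖h (chart θ p)‖ ^ 2 := by
    rw [← (chart_mp θ).setIntegral_preimage_emb (chart θ).measurableEmbedding]
    congr 2
    ext p
    simp [boxQ]
  rw [htr]
  refine le_trans ?_ hcs
  have hnn : 0 ≤ w / (16 * π) * Real.log (R / 2 / α) := by positivity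
  exact pow_le_pow_left₀ hnn (hnorm.trans hle) 2

/-! ### The norm of `f` and the disjointness of the boxes -/

lemma norm_f_le (N : ℕ) (hN : 10 < N) :
    ∫ x : Plane, ‖demeterF N x‖ ^ 2 ≤ 2 * π * Real.log N := by
  have hN0 : (0:ℝ) < N := by exact_mod_cast (by omega : 0 < N)
  have hN10 : (10:ℝ) < N := by exact_mod_cast hN
  set r0 := 10 * (N:ℝ) ^ (-9 : ℤ) with hr0
  set R := (N:ℝ) ^ (-8 : ℤ) with hR
  have hrR : R = r0 * (N / 10) := by
    rw [hr0, hR, show (-8 : ℤ) = -9 + 1 by norm_num, zpow_add_one₀ hN0.ne']; ring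
  have h0 : 0 < r0 := by positivity
  have hR0 : 0 < R := by positivity
  have h0R : r0 ≤ R := by
    rw [hrR]; exact le_mul_of_one_le_right h0.le (by linarith)
  have h1 : ∀ x : Plane, ‖demeterF N x‖ ^ 2 = (fun t => prof r0 R t ^ 2) ‖x‖ := by
    intro x
    rw [demeter_prof, Complex.norm_real, Real.norm_eq_abs, sq_abs]
  simp_rw [h1]
  rw [integral_fun_norm_addHaar (volume : Measure Plane) (fun t => prof r0 R t ^ 2)]
  have h2 : ∫ y in Set.Ioi (0:ℝ), y ^ (Module.finrank ℝ Plane - 1) • prof r0 R y ^ 2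
      = Real.log (R / r0) := by
    have h3 : ∀ y ∈ Set.Ioi (0:ℝ), y ^ (Module.finrank ℝ Plane - 1) • prof r0 R y ^ 2
        = Set.indicator (Set.Ico r0 R) (fun y => 1 / y) y := by
      intro y hy
      have hy0 : y ≠ 0 := (Set.mem_Ioi.1 hy).ne'
      simp only [finrank_euclideanSpace, Fintype.card_fin, Set.indicator, Set.mem_Ico, prof]
      split_ifs
      · simp; field_simp
      · simp
    have hsub : Set.Ioi (0:ℝ) ∩ Set.Ico r0 R = Set.Ico r0 R :=
      Set.inter_eq_right.2 (fun y hy => Set.mem_Ioi.2 (h0.trans_le (Set.mem_Ico.1 hy).1))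
    rw [setIntegral_congr_fun measurableSet_Ioi h3, setIntegral_indicator measurableSet_Ico,
      hsub, integral_Ico_eq_integral_Ioc,
      ← intervalIntegral.integral_of_le h0R, integral_one_div_of_pos h0 hR0]
  rw [h2]
  have h4 : (volume : Measure Plane).real (Metric.ball 0 1) = π := by
    rw [measureReal_def, EuclideanSpace.volume_ball_fin_two]
    simp [Real.pi_nonneg]
  rw [h4]
  have h5 : Real.log (R / r0) ≤ Real.log N := by
    apply Real.log_le_log (by positivity)
    rw [hrR, mul_div_cancel_left₀ _ h0.ne']; linarith
  simp only [finrank_euclideanSpace, Fintype.card_fin, smul_eq_mul, nsmul_eq_mul]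
  push_cast
  rw [← mul_assoc]
  exact mul_le_mul_of_nonneg_left h5 (by positivity)

lemma sin_sep (N m : ℕ) (h1 : 1 ≤ m) (h2 : m + 1 ≤ N) : 2 / (N:ℝ) ≤ Real.sin (π * m / N) := by
  have hN0 : (0:ℝ) < N := by exact_mod_cast (by omega : 0 < N)
  have h1' : (1:ℝ) ≤ m := by exact_mod_cast h1
  have h2' : (m:ℝ) + 1 ≤ N := by exact_mod_cast h2
  have hpi := Real.pi_pos
  by_cases hm : 2 * (m:ℝ) ≤ N
  · have := Real.mul_le_sin (x := π * m / N) (by positivity) (by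
      rw [div_le_div_iff₀ hN0 (by norm_num)]; nlinarith)
    refine le_trans ?_ this
    rw [show 2 / π * (π * m / N) = 2 * m / N by field_simp]
    gcongr; linarith
  · push Not at hm
    rw [← Real.sin_pi_sub]
    have e : π - π * m / N = π * (N - m) / N := by field_simp
    rw [e]
    have := Real.mul_le_sin (x := π * (N - m) / N) (div_nonneg (mul_nonneg hpi.le (by linarith)) hN0.le) (by
      rw [div_le_div_iff₀ hN0 (by norm_num)]; nlinarith)
    refine le_trans ?_ this
    rw [show 2 / π * (π * (N - m) / N) = 2 * (N - m) / N by field_simp]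
    gcongr; linarith

lemma sin_sep' (N : ℕ) (k l : Fin N) (hkl : k ≠ l) :
    2 / (N:ℝ) ≤ |Real.sin (π * ((k : ℕ) + 1) / N - π * ((l : ℕ) + 1) / N)| := by
  have hne : (k:ℕ) ≠ l := fun h => hkl (Fin.ext h)
  rcases lt_or_gt_of_ne hne with h | h
  · have := sin_sep N (l - k) (by omega) (by have := l.2; omega)
    rw [Nat.cast_sub h.le] at this
    rw [← abs_neg, ← Real.sin_neg]
    refine this.trans (le_trans (le_of_eq ?_) (le_abs_self _))
    congr 1; ring
  · have := sin_sep N (k - l) (by omega) (by have := k.2; omega)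
    rw [Nat.cast_sub h.le] at this
    refine this.trans (le_trans (le_of_eq ?_) (le_abs_self _))
    congr 1; ring

lemma box_disj (N : ℕ) (hN : 0 < N) (R : ℝ) (hR : 0 < R) (a b : Fin N × ℕ) (hab : a ≠ b) :
    Disjoint
      (boxQ (π * ((a.1 : ℕ) + 1) / N) (4 * R * 3 ^ a.2) (4 * R * 3 ^ a.2 / (4 * N)))
      (boxQ (π * ((b.1 : ℕ) + 1) / N) (4 * R * 3 ^ b.2) (4 * R * 3 ^ b.2 / (4 * N))) := by
  have hN0 : (1:ℝ) ≤ N := by exact_mod_cast hN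
  rw [Set.disjoint_left]
  intro x hx hy
  by_cases hk : a.1 = b.1
  · have hj : a.2 ≠ b.2 := fun h => hab (Prod.ext hk h)
    rw [← hk] at hy
    obtain ⟨⟨h1, h2⟩, -⟩ := hx
    obtain ⟨⟨h3, h4⟩, -⟩ := hy
    have h3pow : ∀ i j : ℕ, i < j → 3 * (3:ℝ) ^ i ≤ 3 ^ j := by
      intro i j hij
      rw [← pow_succ']
      exact pow_le_pow_right₀ (by norm_num) hij
    rcases lt_or_gt_of_ne hj with h | h
    · have := h3pow _ _ h
      nlinarith
    · have := h3pow _ _ h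
      nlinarith
  · have hsin := sin_sep' N a.1 b.1 hk
    set θ := π * ((a.1 : ℕ) + 1) / N with hθ
    set η := π * ((b.1 : ℕ) + 1) / N with hη
    have hxy : ∀ ζ ρ : ℝ, 0 < ρ → x ∈ boxQ ζ ρ (ρ / (4 * N)) →
        0 < ((chart ζ).symm x).1 ∧ |((chart ζ).symm x).2| < ((chart ζ).symm x).1 / (2 * N) := by
      rintro ζ ρ hρ ⟨h1, h2⟩
      have h1 := h1.1
      refine ⟨by linarith, (abs_lt.2 h2).trans ?_⟩
      rw [div_lt_div_iff₀ (by positivity) (by positivity)]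
      nlinarith
    obtain ⟨p1, p2⟩ := hxy θ _ (by positivity) hx
    obtain ⟨q1, q2⟩ := hxy η _ (by positivity) hy
    rw [chart_symm_apply] at p1 p2 q1 q2
    simp only at p1 p2 q1 q2
    set s := x 0 * Real.cos θ + x 1 * Real.sin θ with hs
    set t := - x 0 * Real.sin θ + x 1 * Real.cos θ with ht
    have e1 : x 0 * Real.cos η + x 1 * Real.sin η = s * Real.cos (θ - η) - t * Real.sin (θ - η) := by
      rw [Real.cos_sub, Real.sin_sub, hs, ht]
      have := Real.sin_sq_add_cos_sq θ
      linear_combination -(x 0 * Real.cos η + x 1 * Real.sin η) * this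
    have e2 : - x 0 * Real.sin η + x 1 * Real.cos η = s * Real.sin (θ - η) + t * Real.cos (θ - η) := by
      rw [Real.cos_sub, Real.sin_sub, hs, ht]
      have := Real.sin_sq_add_cos_sq θ
      linear_combination -(- x 0 * Real.sin η + x 1 * Real.cos η) * this
    rw [e2, e1] at q2
    have hc1 := Real.abs_cos_le_one (θ - η)
    have hs1 := Real.abs_sin_le_one (θ - η)
    have b1 : s * Real.cos (θ - η) - t * Real.sin (θ - η) ≤ s + |t| := by
      have h1 : s * Real.cos (θ - η) ≤ s := mul_le_of_le_one_right p1.le (Real.cos_le_one _)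
      have h2 : -(t * Real.sin (θ - η)) ≤ |t| := by
        refine (neg_le_abs _).trans ?_
        rw [abs_mul]
        exact mul_le_of_le_one_right (abs_nonneg _) hs1
      linarith
    have b2 : s * (2 / N) - |t| ≤ |s * Real.sin (θ - η) + t * Real.cos (θ - η)| := by
      have h1 : s * (2 / N) ≤ |s * Real.sin (θ - η)| := by
        rw [abs_mul, abs_of_pos p1]
        exact mul_le_mul_of_nonneg_left hsin p1.le
      have h2 : |t * Real.cos (θ - η)| ≤ |t| := by
        rw [abs_mul]
        exact mul_le_of_le_one_right (abs_nonneg _) hc1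
      have h3 := abs_sub_abs_le_abs_sub (s * Real.sin (θ - η)) (-(t * Real.cos (θ - η)))
      rw [abs_neg, sub_neg_eq_add] at h3
      linarith
    have b3 : |t| < s := p2.trans_le (div_le_self p1.le (by linarith))
    have b4 : (s * Real.cos (θ - η) - t * Real.sin (θ - η)) / (2 * N) ≤ (2 * s) / (2 * N) := by
      gcongr; linarith
    have b5 : s * (2 / N) - s / (2 * N) < 2 * s / (2 * N) := by linarith
    have b6 : s * (2 / N) - s / (2 * N) = 3 / 2 * (s / N) := by field_simp; norm_num
    have b7 : 2 * s / (2 * N) = s / N := by field_simp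
    have b8 : 0 < s / N := by positivity
    linarith

/-! ### Main theorem -/

lemma one_box (N : ℕ) (hN : 10 ^ 7 < N) (θ : ℝ) (h : Plane → ℂ)
    (hL : MemLp h 2 (volume : Measure Plane))
    (hh : HasFourierTransform h
      (fun ξ => Set.indicator (halfPlane θ) (fun _ => 1) ξ * 𝓕 (demeterF N) ξ))
    (R ρ : ℝ) (hRN : R = (N:ℝ) ^ (-8 : ℤ)) (hρ : 4 * R ≤ ρ) (hρ2 : ρ ≤ R * √N) :
    Real.log N ^ 2 / (32768 * π ^ 2 * N) ≤
      ∫ x in boxQ θ ρ (ρ / (4 * N)), ‖h x‖ ^ 2 := by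
  have hN7 : (10:ℝ) ^ 7 < N := by exact_mod_cast hN
  have hN0 : (0:ℝ) < N := by linarith [show (0:ℝ) < 10 ^ 7 by norm_num]
  set S := √(N:ℝ) with hS
  have hSS : S * S = N := Real.mul_self_sqrt hN0.le
  have hS10 : 10 ≤ S := Real.le_sqrt_of_sq_le (by norm_num at hN7 ⊢; linarith)
  have hS0 : 0 < S := by linarith
  have hR0 : 0 < R := by rw [hRN]; positivity
  have hρ0 : 0 < ρ := by linarith
  have hr0 : 10 * (N:ℝ) ^ (-9 : ℤ) = 10 * R / N := by
    rw [hRN, show (-9 : ℤ) = -8 - 1 by norm_num, zpow_sub_one₀ hN0.ne']; ring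
  have hbox := box_lower N θ h hL hh (10 * (N:ℝ) ^ (-9 : ℤ)) R (R / S) ρ (ρ / (4 * N)) rfl hRN
    (by positivity) (by
      rw [hr0, div_le_div_iff₀ hN0 hS0, ← hSS]
      nlinarith [mul_pos hR0 hS0]) (by
      gcongr; linarith) (by positivity) (by
      rw [div_div, div_le_div_iff₀ (by positivity) hS0]
      calc ρ * S ≤ R * S * S := by gcongr
        _ = R * N := by rw [mul_assoc, hSS]
        _ ≤ R * (4 * N * 2) := by gcongr; linarith) hρ
  have e : R / 2 / (R / S) = S / 2 := by field_simp
  rw [e] at hbox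
  have hlog : Real.log N / 4 ≤ Real.log (S / 2) := by
    rw [Real.log_div hS0.ne' (by norm_num), hS, Real.log_sqrt hN0.le]
    have h16 : Real.log (2 ^ 4) ≤ Real.log N := by
      apply Real.log_le_log (by norm_num)
      norm_num at hN7 ⊢; linarith
    rw [Real.log_pow] at h16
    push_cast at h16
    linarith
  have hlN : 0 ≤ Real.log N := Real.log_nonneg (by linarith [show (1:ℝ) < 10 ^ 7 by norm_num])
  set I := ∫ x in boxQ θ ρ (ρ / (4 * N)), ‖h x‖ ^ 2 with hI
  have h1 : (ρ / (4 * N) / (16 * π) * (Real.log N / 4)) ^ 2 ≤ 2 * ρ * (ρ / (4 * N)) * I := by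
    refine le_trans ?_ hbox
    gcongr
  have h2 : (ρ / (4 * N) / (16 * π) * (Real.log N / 4)) ^ 2
      = (2 * ρ * (ρ / (4 * N))) * (Real.log N ^ 2 / (32768 * π ^ 2 * N)) := by
    have := Real.pi_pos
    field_simp
    ring
  rw [h2] at h1
  exact le_of_mul_le_mul_left h1 (by positivity)

/-- Demeter's lower bound: with `θ_k = πk/N`, and `h_k = T_{Γ_{θ_k}} f` the multiplier operator
of the half-plane applied to `f`, one has `‖sup_k |h_k|‖₂ ≥ c (log N) ‖f‖₂`. -/
theorem statement4 :
    ∃ c : ℝ, 0 < c ∧ ∃ N₀ : ℕ, ∀ N : ℕ, N₀ < N →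
      ∀ h : Fin N → Plane → ℂ,
        (∀ k, MemLp (h k) 2 (volume : Measure Plane)) →
        (∀ k : Fin N, HasFourierTransform (h k)
          (fun ξ => Set.indicator (halfPlane (Real.pi * ((k : ℕ) + 1) / N)) (fun _ => 1) ξ *
            𝓕 (demeterF N) ξ)) →
        c * Real.log N * l2norm2 (demeterF N) ≤
          l2norm2 (fun x => ⨆ k : Fin N, ‖h k x‖) := by
  refine ⟨1 / 10000, by norm_num, 10 ^ 7, ?_⟩
  intro N hN h hL hh
  have hN7 : (10:ℝ) ^ 7 < N := by exact_mod_cast hN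
  have hN0 : (0:ℝ) < N := by linarith [show (0:ℝ) < 10 ^ 7 by norm_num]
  have hNpos : 0 < N := by exact_mod_cast hN0
  haveI : Nonempty (Fin N) := ⟨⟨0, hNpos⟩⟩
  set L := Real.log N with hLdef
  have hL16 : 16 ≤ L := by
    rw [hLdef, Real.le_log_iff_exp_le hN0]
    have h1 : Real.exp 1 < 2.7182818286 := Real.exp_one_lt_d9
    have h2 : Real.exp 16 = Real.exp 1 ^ 16 := by
      rw [← Real.exp_nat_mul]; norm_num
    rw [h2]
    have h3 : Real.exp 1 ^ 16 ≤ 2.7182818286 ^ 16 :=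
      pow_le_pow_left₀ (Real.exp_pos 1).le h1.le 16
    have h4 : (2.7182818286:ℝ) ^ 16 ≤ 10 ^ 7 := by norm_num
    linarith
  set R := (N:ℝ) ^ (-8 : ℤ) with hR
  have hR0 : 0 < R := by positivity
  set J := ⌊L / 8⌋₊ with hJ
  have hJ1 : L / 16 ≤ J := by
    have := Nat.lt_floor_add_one (L / 8)
    rw [← hJ] at this
    linarith
  have hJ2 : (J:ℝ) ≤ L / 8 := Nat.floor_le (by linarith)
  have hρ2 : ∀ j < J, 4 * R * 3 ^ j ≤ R * √N := by
    intro j hj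
    have hj' : (j:ℝ) ≤ L / 8 := le_trans (by exact_mod_cast hj.le) hJ2
    have h3 : (3:ℝ) ^ j ≤ Real.exp (L / 4) := by
      have h3e : (3:ℝ) ≤ Real.exp 2 := by
        have := Real.add_one_le_exp (2:ℝ); linarith
      calc (3:ℝ) ^ j ≤ Real.exp 2 ^ j := pow_le_pow_left₀ (by norm_num) h3e j
        _ = Real.exp (j * 2) := (Real.exp_nat_mul 2 j).symm
        _ ≤ _ := Real.exp_le_exp.2 (by linarith)
    have h4 : (4:ℝ) ≤ Real.exp (L / 4) := by
      have := Real.add_one_le_exp (L / 4); linarith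
    have h5 : √(N:ℝ) = Real.exp (L / 4) * Real.exp (L / 4) := by
      rw [← Real.exp_add, Real.sqrt_eq_iff_mul_self_eq hN0.le (Real.exp_pos _).le, ← Real.exp_add,
        show L / 4 + L / 4 + (L / 4 + L / 4) = L by ring, Real.exp_log hN0]
    rw [h5]
    calc 4 * R * 3 ^ j = R * (4 * 3 ^ j) := by ring
      _ ≤ R * (Real.exp (L / 4) * Real.exp (L / 4)) := by gcongr
  -- the maximal function
  set M : Plane → ℝ := fun x => ⨆ k : Fin N, ‖h k x‖ with hM
  have hMk : ∀ k x, ‖h k x‖ ≤ M x := fun k x =>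
    le_ciSup (f := fun k => ‖h k x‖) (Set.finite_range _).bddAbove k
  have hM0 : ∀ x, 0 ≤ M x := fun x => (norm_nonneg _).trans (hMk ⟨0, hNpos⟩ x)
  have hMi : Integrable (fun x => ‖M x‖ ^ 2) := by
    have hsum : Integrable (fun x => ∑ k : Fin N, ‖h k x‖ ^ 2) :=
      integrable_finset_sum _ fun k _ => (hL k).integrable_norm_pow (by norm_num)
    refine hsum.mono' ?_ ?_
    · have : AEMeasurable M := AEMeasurable.iSup fun k => (hL k).aestronglyMeasurable.norm.aemeasurable
      exact (this.norm.pow_const 2).aestronglyMeasurable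
    · refine Filter.Eventually.of_forall fun x => ?_
      obtain ⟨k, hk⟩ := exists_eq_ciSup_of_finite (f := fun k : Fin N => ‖h k x‖)
      rw [Real.norm_eq_abs, abs_of_nonneg (by positivity), Real.norm_eq_abs, sq_abs]
      have : M x = ‖h k x‖ := hk.symm
      rw [this]
      exact Finset.single_le_sum (f := fun k => ‖h k x‖ ^ 2) (fun i _ => by positivity) (Finset.mem_univ k)
  set Q : Fin N × ℕ → Set Plane := fun a =>
    boxQ (π * ((a.1 : ℕ) + 1) / N) (4 * R * 3 ^ a.2) (4 * R * 3 ^ a.2 / (4 * N)) with hQ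
  set T : Finset (Fin N × ℕ) := Finset.univ ×ˢ Finset.range J with hT
  have hbox : ∀ a ∈ T, L ^ 2 / (32768 * π ^ 2 * N) ≤ ∫ x in Q a, ‖M x‖ ^ 2 := by
    intro a ha
    have haJ : a.2 < J := by simpa [hT] using ha
    have h1 := one_box N hN _ (h a.1) (hL a.1) (hh a.1) R (4 * R * 3 ^ a.2) hR
      (le_mul_of_one_le_right (by positivity) (one_le_pow₀ (by norm_num))) (hρ2 _ haJ)
    refine h1.trans ?_
    refine setIntegral_mono (Integrable.integrableOn ((hL a.1).integrable_norm_pow (by norm_num)))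
      hMi.integrableOn fun x => ?_
    have := hMk a.1 x
    rw [Real.norm_eq_abs (M x), abs_of_nonneg (hM0 x)]
    gcongr
  have hunion : ∑ a ∈ T, ∫ x in Q a, ‖M x‖ ^ 2 ≤ ∫ x, ‖M x‖ ^ 2 := by
    rw [← integral_biUnion_finset T (fun a _ => boxQ_meas _ _ _)
      (fun a _ b _ hab => box_disj N hNpos R hR0 a b hab) (fun a _ => hMi.integrableOn)]
    exact setIntegral_le_integral hMi (Filter.Eventually.of_forall fun x => by positivity)
  have hsum : L ^ 3 / (524288 * π ^ 2) ≤ ∫ x, ‖M x‖ ^ 2 := by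
    refine le_trans ?_ hunion
    refine le_trans ?_ (Finset.card_nsmul_le_sum T _ _ hbox)
    have hcard : T.card = N * J := by simp [hT]
    rw [hcard, nsmul_eq_mul]
    push_cast
    have hpi := Real.pi_pos
    calc L ^ 3 / (524288 * π ^ 2) = (N * (L / 16)) * (L ^ 2 / (32768 * π ^ 2 * N)) := by
          field_simp; norm_num
      _ ≤ _ := by gcongr
  have hf := norm_f_le N (by omega)
  unfold l2norm2
  rw [← Real.sqrt_eq_rpow, ← Real.sqrt_eq_rpow]
  apply Real.le_sqrt_of_sq_le
  rw [mul_pow, Real.sq_sqrt (integral_nonneg fun x => by positivity)]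
  refine le_trans ?_ hsum
  calc (1 / 10000 * L) ^ 2 * ∫ x, ‖demeterF N x‖ ^ 2 ≤ (1 / 10000 * L) ^ 2 * (2 * π * L) := by gcongr
    _ ≤ L ^ 3 / (524288 * π ^ 2) := by
      have hpi := Real.pi_pos
      have hpi2 : π < 3.15 := Real.pi_lt_d2
      rw [le_div_iff₀ (by positivity)]
      have h3 : π ^ 3 ≤ 3.15 ^ 3 := pow_le_pow_left₀ hpi.le hpi2.le 3
      have hL3 : 0 ≤ L ^ 3 := by positivity
      calc (1 / 10000 * L) ^ 2 * (2 * π * L) * (524288 * π ^ 2)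
          = L ^ 3 * (π ^ 3 * (1048576 / 100000000)) := by ring
        _ ≤ L ^ 3 * 1 := by
          gcongr
          norm_num at h3 ⊢
          linarith
        _ = L ^ 3 := mul_one _
end
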